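/- arXiv:2106.04268 — 3 statements merged into one kernel-verified Lean document; each statement's English description precedes it below -/
import Mathlib

section
/- Let S = Sym(V) be the symmetric algebra on a finite-dimensional vector space V over a field k, with k viewed as the S-module S/S·V. Then Tor_i^S(k, k) is isomorphic to the i-th exterior power ⋀^i V. -/
open CategoryTheory

/-- The residue field `k = S/S·V` of the symmetric algebra `S = Sym(V)` on
`V = k^n` (realized as the polynomial algebra `k[x_1,...,x_n]`), as an `S`-module
via evaluation at `0`. -/
noncomputable instance residueFieldModule (k : Type) [Field k] (n : ℕ) :
    Module (MvPolynomial (Fin n) k) k :=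
  Module.compHom k (MvPolynomial.eval (0 : Fin n → k))

section Length

open scoped ModuleCat

universe u

variable {k R : Type u} [Field k] [CommRing R] [Algebra k R]

lemma ModuleCat.length_eq_add_of_shortExact {S : ShortComplex (ModuleCat.{u} R)}
    (hS : S.ShortExact) :
    Module.length k S.X₂ = Module.length k S.X₁ + Module.length k S.X₃ :=
  Module.length_eq_add_of_exact (S.f.hom.restrictScalars k) (S.g.hom.restrictScalars k)
    hS.moduleCat_injective_f hS.moduleCat_surjective_g
    ((ShortComplex.ShortExact.moduleCat_exact_iff_function_exact S).1 hS.exact)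

lemma ModuleCat.length_eq_of_iso {M N : ModuleCat.{u} R} (e : M ≅ N) :
    Module.length k M = Module.length k N :=
  (e.toLinearEquiv.restrictScalars k).length_eq

lemma ModuleCat.length_eq_one_of_addEquiv {N : ModuleCat.{u} R} (e : N ≃+ k)
    (he : ∀ (c : k) (x : N), e (algebraMap k R c • x) = c * e x) : Module.length k N = 1 := by
  let f : N ≃ₗ[k] k :=
    { e with map_smul' := fun c x ↦ (congrArg e (algebraMap_smul R c x).symm).trans (he c x) }
  rw [f.length_eq, Module.length_eq_finrank, Module.finrank_self, Nat.cast_one]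

variable {S : ShortComplex (ChainComplex (ModuleCat.{u} R) ℕ)}

lemma length_homology_succ_of_homologyMap_eq_zero (hS : S.ShortExact)
    (h : ∀ i, HomologicalComplex.homologyMap S.f i = 0) (i : ℕ) :
    Module.length k (S.X₃.homology (i + 1)) =
      Module.length k (S.X₂.homology (i + 1)) + Module.length k (S.X₁.homology i) := by
  have hi : (ComplexShape.down ℕ).Rel (i + 1) i := by simp
  exact ModuleCat.length_eq_add_of_shortExact
    { exact := hS.homology_exact₃ (i + 1) i hi
      mono_f := (hS.homology_exact₂ (i + 1)).mono_g (h _)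
      epi_g := (hS.homology_exact₁ (i + 1) i hi).epi_f (h _) }

lemma length_homology_zero_of_homologyMap_eq_zero (hS : S.ShortExact)
    (h : HomologicalComplex.homologyMap S.f 0 = 0) :
    Module.length k (S.X₃.homology 0) = Module.length k (S.X₂.homology 0) := by
  have : Mono (HomologicalComplex.homologyMap S.g 0) := (hS.homology_exact₂ 0).mono_g h
  have := hS.epi_g
  have : Epi (HomologicalComplex.homologyMap S.g 0) :=
    HomologicalComplex.epi_homologyMap_of_epi_of_not_rel S.g 0 (by simp)
  have := isIso_of_mono_of_epi (HomologicalComplex.homologyMap S.g 0)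
  exact (ModuleCat.length_eq_of_iso (asIso (HomologicalComplex.homologyMap S.g 0))).symm

end Length

section Tensor

open MonoidalCategory

universe u

variable {R : Type u} [CommRing R]

/-- The complex `M ⊗ P` obtained by tensoring each term of `P` with `M` on the left. -/
noncomputable abbrev tensorComplex (P : ChainComplex (ModuleCat.{u} R) ℕ) (M : ModuleCat.{u} R) :
    ChainComplex (ModuleCat.{u} R) ℕ :=
  (((tensoringLeft _).obj M).mapHomologicalComplex _).obj P

/-- The morphism `M ⊗ P ⟶ N ⊗ P` induced by `f : M ⟶ N`. -/
noncomputable abbrev tensorComplexMap (P : ChainComplex (ModuleCat.{u} R) ℕ)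
    {M N : ModuleCat.{u} R} (f : M ⟶ N) : tensorComplex P M ⟶ tensorComplex P N :=
  (NatTrans.mapHomologicalComplex ((tensoringLeft _).map f) _).app P

/-- An isomorphism `M ≅ N` induces isomorphisms on the homology of `M ⊗ P` and `N ⊗ P`. -/
noncomputable def tensorComplexHomologyIso (P : ChainComplex (ModuleCat.{u} R) ℕ)
    {M N : ModuleCat.{u} R} (e : M ≅ N) (i : ℕ) :
    (tensorComplex P M).homology i ≅ (tensorComplex P N).homology i :=
  (HomologicalComplex.homologyFunctor _ _ i).mapIso
    ((NatIso.mapHomologicalComplex ((tensoringLeft _).mapIso e) _).app P)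

/-- Tensoring a short complex of modules with a complex `P`. -/
noncomputable abbrev tensorShortComplex (P : ChainComplex (ModuleCat.{u} R) ℕ)
    (S : ShortComplex (ModuleCat.{u} R)) : ShortComplex (ChainComplex (ModuleCat.{u} R) ℕ) :=
  ShortComplex.mk (tensorComplexMap P S.f) (tensorComplexMap P S.g) (by
    ext1 i
    exact (comp_whiskerRight S.f S.g (P.X i)).symm.trans
      (by rw [S.zero, MonoidalPreadditive.zero_whiskerRight]; rfl))

lemma tensorShortComplex_shortExact (P : ChainComplex (ModuleCat.{u} R) ℕ)
    [∀ i, Projective (P.X i)] {S : ShortComplex (ModuleCat.{u} R)} (hS : S.ShortExact) :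
    (tensorShortComplex P S).ShortExact := by
  refine HomologicalComplex.shortExact_of_degreewise_shortExact _ fun i ↦
    ModuleCat.shortComplex_shortExact _ ?_ ?_ ?_
  · exact Module.Flat.rTensor_exact (P.X i)
      ((ShortComplex.ShortExact.moduleCat_exact_iff_function_exact S).1 hS.exact)
  · exact Module.Flat.rTensor_preserves_injective_linearMap S.f.hom hS.moduleCat_injective_f
  · exact LinearMap.rTensor_surjective (P.X i) hS.moduleCat_surjective_g

lemma homologyMap_tensorComplexMap_smul_id {N : ModuleCat.{u} R} (P : ProjectiveResolution N)
    {r : R} (hr : r • 𝟙 N = 0) (M : ModuleCat.{u} R) (i : ℕ) :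
    HomologicalComplex.homologyMap (tensorComplexMap P.complex (r • 𝟙 M)) i = 0 := by
  have hπ : r • P.π = P.π ≫ (ChainComplex.single₀ _).map (r • 𝟙 N) := by
    ext1
    exact (congrArg (r • ·) (Category.comp_id (P.π.f 0)).symm).trans
      (Linear.comp_smul _ _ _ (P.π.f 0) r (𝟙 N)).symm
  have h : Homotopy (r • 𝟙 P.complex) 0 := ProjectiveResolution.liftHomotopyZero _ (by
    rw [Linear.smul_comp, Category.id_comp, hπ, hr, Functor.map_zero, Limits.comp_zero])
  have e : tensorComplexMap P.complex (r • 𝟙 M) =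
      (((tensoringLeft _).obj M).mapHomologicalComplex _).map (r • 𝟙 P.complex) := by
    ext1 i
    exact (MonoidalLinear.smul_whiskerRight r (𝟙 M) (P.complex.X i)).trans
      ((congrArg (r • ·) ((id_whiskerRight M (P.complex.X i)).trans
        (whiskerLeft_id M (P.complex.X i)).symm)).trans
        (MonoidalLinear.whiskerLeft_smul M r (𝟙 (P.complex.X i))).symm)
  rw [e, (((tensoringLeft _).obj M).mapHomotopy h).homologyMap_eq i, Functor.map_zero,
    HomologicalComplex.homologyMap_zero]

/-- Tensoring a complex with the unit object does not change it. -/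
noncomputable def tensorComplexUnitIso (P : ChainComplex (ModuleCat.{u} R) ℕ) :
    tensorComplex P (𝟙_ _) ≅ P :=
  HomologicalComplex.Hom.isoOfComponents (fun i ↦ λ_ (P.X i))
    (fun i j _ ↦ (leftUnitor_naturality (P.d i j)).symm)

end Tensor

section Quotient

universe u

lemma quotient_smul_shortExact {A : Type u} [CommRing A] {I J : Ideal A} {r : A} (hIJ : I ≤ J)
    (hJ : J = Ideal.span {r} ⊔ I) (hr : ∀ f, r * f ∈ I → f ∈ I)
    (w : (r • 𝟙 (ModuleCat.of A (A ⧸ I))) ≫ ModuleCat.ofHom (Submodule.factor hIJ) = 0) :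
    (ShortComplex.mk (r • 𝟙 (ModuleCat.of A (A ⧸ I)))
      (ModuleCat.ofHom (Submodule.factor hIJ)) w).ShortExact := by
  refine ModuleCat.shortComplex_shortExact _ (.of_comp_of_mem_range ?_ ?_) ?_ ?_
  · exact congrArg (fun f : ModuleCat.of A (A ⧸ I) ⟶ ModuleCat.of A (A ⧸ J) ↦ ⇑f.hom) w
  · intro x hx
    obtain ⟨f, rfl⟩ := Submodule.Quotient.mk_surjective I x
    have hf : f ∈ J := (Submodule.Quotient.mk_eq_zero J).1 hx
    rw [hJ, Submodule.mem_sup] at hf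
    obtain ⟨b, hb, c, hc, rfl⟩ := hf
    obtain ⟨d, rfl⟩ := Ideal.mem_span_singleton'.1 hb
    refine ⟨Submodule.Quotient.mk d, (Submodule.Quotient.eq I).2 ?_⟩
    have : r • d - (d * r + c) = -c := by rw [smul_eq_mul]; ring
    rw [this]
    exact neg_mem hc
  · refine (injective_iff_map_eq_zero (r • LinearMap.id : (A ⧸ I) →ₗ[A] (A ⧸ I))).2 fun x hx ↦ ?_
    obtain ⟨f, rfl⟩ := Submodule.Quotient.mk_surjective I x
    exact (Submodule.Quotient.mk_eq_zero I).2 (hr f ((Submodule.Quotient.mk_eq_zero I).1 hx))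
  · exact Submodule.factor_surjective hIJ

end Quotient

namespace MvPolynomial

variable {R σ : Type*} [CommSemiring R]

lemma mem_span_X_image_of_X_mul_mem {s : Set σ} {a : σ} (ha : a ∉ s) {f : MvPolynomial σ R}
    (h : X a * f ∈ Ideal.span (X '' s : Set (MvPolynomial σ R))) :
    f ∈ Ideal.span (X '' s : Set (MvPolynomial σ R)) := by
  classical
  rw [mem_ideal_span_X_image] at h ⊢
  intro m hm
  obtain ⟨i, hi, hmi⟩ := h (Finsupp.single a 1 + m)
    (by simpa [mem_support_iff, coeff_X_mul] using hm)
  have : a ≠ i := fun h ↦ ha (h ▸ hi)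
  exact ⟨i, hi, by simpa [this] using hmi⟩

lemma mem_span_X_image_univ_iff {f : MvPolynomial σ R} :
    f ∈ Ideal.span (X '' Set.univ : Set (MvPolynomial σ R)) ↔ eval 0 f = 0 := by
  rw [mem_ideal_span_X_image, eval_zero, constantCoeff_eq]
  refine ⟨fun h ↦ ?_, fun h m hm ↦ ?_⟩
  · by_contra h0
    simpa using h 0 (mem_support_iff.2 h0)
  · by_contra! hm'
    obtain rfl : m = 0 := by
      ext i
      simpa using hm' i
    exact mem_support_iff.1 hm h

end MvPolynomial

section TorDimension

open MonoidalCategory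
open scoped ModuleCat

universe u

variable {k : Type u} [Field k]

lemma length_homology_tensorComplex_unit {R : Type u} [CommRing R] [Algebra k R]
    {N : ModuleCat.{u} R} (P : ProjectiveResolution N) (hN : Module.length k N = 1) (i : ℕ) :
    Module.length k ((tensorComplex P.complex (𝟙_ _)).homology i) = (Nat.choose 0 i : ℕ∞) := by
  have e : (tensorComplex P.complex (𝟙_ _)).homology i ≅ HomologicalComplex.homology _ i :=
    (HomologicalComplex.homologyFunctor _ _ i).mapIso (tensorComplexUnitIso P.complex) ≪≫
      isoOfQuasiIsoAt P.π i
  rw [ModuleCat.length_eq_of_iso e]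
  cases i with
  | zero =>
    rw [ModuleCat.length_eq_of_iso (HomologicalComplex.singleObjHomologySelfIso _ 0 N), hN,
      Nat.choose_self, Nat.cast_one]
  | succ i =>
    have := ModuleCat.subsingleton_of_isZero
      (HomologicalComplex.isZero_single_obj_homology (ComplexShape.down ℕ) 0 N (i + 1) (by simp))
    rw [Nat.choose_zero_succ]
    exact Module.length_eq_zero

/-- If `N` is one-dimensional over `k` and killed by all variables, then
`Tor_i(k[σ]/(x_j)_{j ∈ s}, N)` has dimension `s.card.choose i`. -/
lemma length_homology_tensorComplex_quotient_span_X {σ : Type u} (s : Finset σ)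
    {N : ModuleCat.{u} (MvPolynomial σ k)} (P : ProjectiveResolution N)
    (hX : ∀ a, (MvPolynomial.X a : MvPolynomial σ k) • 𝟙 N = 0)
    (hN : Module.length k N = 1) (i : ℕ) :
    Module.length k ((tensorComplex P.complex (ModuleCat.of _ (MvPolynomial σ k ⧸
      Ideal.span (MvPolynomial.X '' s : Set (MvPolynomial σ k))))).homology i) =
        (s.card.choose i : ℕ∞) := by
  classical
  induction s using Finset.induction_on generalizing i with
  | empty =>
    rw [Finset.card_empty, ← length_homology_tensorComplex_unit P hN]
    exact ModuleCat.length_eq_of_iso (tensorComplexHomologyIso P.complex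
      (Submodule.quotEquivOfEqBot _ (by simp)).toModuleIso i)
  | insert a s ha ih =>
    have hJ : Ideal.span (MvPolynomial.X '' (insert a s : Finset σ) : Set (MvPolynomial σ k)) =
        Ideal.span {MvPolynomial.X a} ⊔ Ideal.span (MvPolynomial.X '' (s : Set σ)) := by
      rw [Finset.coe_insert, Set.image_insert_eq, Ideal.span_insert]
    have hS := tensorShortComplex_shortExact P.complex
      (quotient_smul_shortExact (hJ ▸ le_sup_right) hJ
        (fun f ↦ MvPolynomial.mem_span_X_image_of_X_mul_mem (by simpa using ha)) (by
          ext
          exact (Submodule.Quotient.mk_eq_zero _).2 (Ideal.mul_mem_right _ _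
            (Ideal.subset_span ⟨a, by simp, rfl⟩))))
    have h₀ := homologyMap_tensorComplexMap_smul_id P (hX a)
    rw [Finset.card_insert_of_notMem ha]
    cases i with
    | zero =>
      rw [length_homology_zero_of_homologyMap_eq_zero (k := k) hS (h₀ _ 0), ih,
        Nat.choose_zero_right, Nat.choose_zero_right]
    | succ i =>
      rw [length_homology_succ_of_homologyMap_eq_zero (k := k) hS (h₀ _), ih, ih,
        Nat.choose_succ_succ, Nat.cast_add, add_comm]

end TorDimension

/-- The residue field as the quotient of the polynomial ring by all the variables. -/
noncomputable def quotientSpanXEquivResidueField (k : Type) [Field k] (n : ℕ) :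
    (MvPolynomial (Fin n) k ⧸ Ideal.span
      (MvPolynomial.X '' (Finset.univ : Finset (Fin n)) : Set (MvPolynomial (Fin n) k)))
      ≃ₗ[MvPolynomial (Fin n) k] k :=
  let g : MvPolynomial (Fin n) k →ₗ[MvPolynomial (Fin n) k] k := LinearMap.toSpanSingleton _ k 1
  have hg (f : MvPolynomial (Fin n) k) : g f = MvPolynomial.eval 0 f := mul_one _
  Submodule.quotEquivOfEq _ _ (by
    ext f
    rw [LinearMap.mem_ker, hg, Finset.coe_univ, MvPolynomial.mem_span_X_image_univ_iff]) ≪≫ₗ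
      g.quotKerEquivOfSurjective fun c ↦ ⟨MvPolynomial.C c, by simp [hg]⟩

/-- Let `S = Sym(V)` be the symmetric algebra on the finite-dimensional vector space
`V = k^n` (i.e. the polynomial ring in `n` variables), with `k = S/S·V` the residue
field as an `S`-module.  Then `Tor_i^S(k, k)` is isomorphic to the `i`-th exterior
power `⋀^i V` (as `k`-vector spaces, the `k`-structure on `Tor` coming from
restriction of scalars along `k → S`). -/
theorem stmt_2 (k : Type) [Field k] (n i : ℕ) :
    let S := MvPolynomial (Fin n) k
    let T : Type := ((Tor (ModuleCat.{0} S) i).obj (ModuleCat.of S k)).obj (ModuleCat.of S k)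
    let _inst : Module k T := Module.compHom T (algebraMap k S)
    Nonempty (T ≃ₗ[k] ⋀[k]^i (Fin n → k)) := by
  intro S T inst
  let N := ModuleCat.of S k
  have hX (a : Fin n) : (MvPolynomial.X a : S) • 𝟙 N = 0 := by
    ext x
    change MvPolynomial.eval (0 : Fin n → k) (MvPolynomial.X a) * x = 0
    simp
  have hN := ModuleCat.length_eq_one_of_addEquiv (N := N) (AddEquiv.refl k) fun c x ↦ by
    change MvPolynomial.eval (0 : Fin n → k) (MvPolynomial.C c) * x = c * x
    simp
  let P := projectiveResolution N
  have hT : Module.length k T = (n.choose i : ℕ∞) := by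
    have h := length_homology_tensorComplex_quotient_span_X Finset.univ P hX hN i
    rw [Finset.card_univ, Fintype.card_fin] at h
    exact (ModuleCat.length_eq_of_iso (P.isoLeftDerivedObj _ i ≪≫ tensorComplexHomologyIso
      P.complex (quotientSpanXEquivResidueField k n).symm.toModuleIso i)).trans h
  have : IsNoetherian k T := (isFiniteLength_iff_isNoetherian_isArtinian.1
    (Module.length_ne_top_iff.1 (by simp [hT] : Module.length k T ≠ ⊤))).1
  refine ⟨LinearEquiv.ofFinrankEq _ _ ?_⟩
  rw [exteriorPower.finrank_eq, Module.finrank_fin_fun]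
  rw [Module.length_eq_finrank] at hT
  exact_mod_cast hT
end

section
/- Let 0 → V' → V → V'' → 0 be a short exact sequence of finite-dimensional representations of a group (or modules over a ring). Then for each j ≥ 0, the j-th exterior power ⋀^j V admits a filtration 0 = M_{-1} ⊆ M_0 ⊆ ... ⊆ M_j = ⋀^j V with subquotients M_k/M_{k-1} ≅ ⋀^{j-k} V' ⊗ ⋀^k V''. -/
open TensorProduct

section

variable {k : Type*} [CommRing k]

open Classical in
/-- A map from a free module to a flat module factors, up to restricting to finitely many
coordinates, through a finite free module, and finitely many relations can be killed. -/
lemma Module.Flat.exists_factorization_finsupp {M ι : Type*} [AddCommGroup M] [Module k M]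
    [Module.Flat k M] (p : (ι →₀ k) →ₗ[k] M) (S : Finset (ι →₀ k)) :
    ∃ (n : ℕ) (e : (ι →₀ k) →ₗ[k] (ι →₀ k)) (a : (ι →₀ k) →ₗ[k] (Fin n →₀ k))
      (b : (Fin n →₀ k) →ₗ[k] M), p ∘ₗ e = b ∘ₗ a ∧ ∀ t ∈ S, e t = t ∧ (p t = 0 → a t = 0) := by
  let s : Set ι := S.biUnion Finsupp.support
  let ρ := Finsupp.restrictDom k k s
  have he : ∀ t ∈ S, (ρ t : ι →₀ k) = t := fun t ht => by
    rw [Finsupp.restrictDom_apply, Finsupp.filter_eq_self_iff]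
    intro x hx
    simp only [s, Finset.coe_biUnion, Set.mem_iUnion]
    exact ⟨t, ht, by simpa using hx⟩
  let K := Submodule.span k {t | t ∈ S ∧ p t = 0}
  have : Module.Finite k K := Module.Finite.span_of_finite k
    (S.finite_toSet.subset fun t ht => ht.1)
  have : Module.Free k (Finsupp.supported k k s) :=
    .of_equiv (Finsupp.supportedEquivFinsupp s).symm
  have : Module.Finite k (Finsupp.supported k k s) :=
    .equiv (Finsupp.supportedEquivFinsupp s).symm
  have hK : K ≤ LinearMap.ker (p ∘ₗ (Finsupp.supported k k s).subtype ∘ₗ ρ) := by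
    rw [Submodule.span_le]
    rintro t ⟨ht, h0⟩
    simp [he t ht, h0]
  have hK' : (p ∘ₗ (Finsupp.supported k k s).subtype) ∘ₗ (ρ ∘ₗ K.subtype) = 0 :=
    LinearMap.ext fun t => hK t.2
  obtain ⟨n, a, b, hab, ha⟩ := Module.Flat.exists_factorization_of_comp_eq_zero_of_free
    (K := K) (N := Finsupp.supported k k s) (f := ρ ∘ₗ K.subtype)
    (x := p ∘ₗ (Finsupp.supported k k s).subtype)
    hK'
  refine ⟨n, (Finsupp.supported k k s).subtype ∘ₗ ρ, a ∘ₗ ρ, b, ?_, fun t ht => ⟨he t ht, ?_⟩⟩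
  · rw [← LinearMap.comp_assoc, hab, LinearMap.comp_assoc]
  · intro h0
    exact LinearMap.congr_fun ha ⟨t, Submodule.subset_span ⟨ht, h0⟩⟩

variable {V' V V'' : Type*}
    [AddCommGroup V'] [Module k V'] [AddCommGroup V''] [Module k V'']
    [AddCommGroup V] [Module k V]

/-- An extension of a flat module is locally split. -/
lemma Module.Flat.exists_local_lift [Module.Flat k V''] {f : V' →ₗ[k] V} {g : V →ₗ[k] V''}
    (hf : Function.Injective f) (hg : Function.Surjective g)
    (hfg : LinearMap.range f = LinearMap.ker g) {ι : Type*} (p : (ι →₀ k) →ₗ[k] V)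
    (S : Finset (ι →₀ k)) :
    ∃ r : (ι →₀ k) →ₗ[k] V', ∀ t ∈ S, g (p t) = 0 → f (r t) = p t := by
  obtain ⟨n, e, a, b, hab, h⟩ := exists_factorization_finsupp (g ∘ₗ p) S
  obtain ⟨c, rfl⟩ := Module.projective_lifting_property g b hg
  let q := (p ∘ₗ e - c ∘ₗ a).codRestrict (LinearMap.range f) fun t => by
    simpa [hfg, sub_eq_zero] using LinearMap.congr_fun hab t
  refine ⟨(LinearEquiv.ofInjective f hf).symm ∘ₗ q, fun t ht h0 => ?_⟩
  have : f ((LinearEquiv.ofInjective f hf).symm (q t)) = q t :=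
    congrArg Subtype.val ((LinearEquiv.ofInjective f hf).apply_symm_apply (q t))
  simp only [LinearMap.comp_apply, LinearEquiv.coe_coe, this]
  simp [q, (h t ht).1, (h t ht).2 (by simpa using h0)]

/-- An alternating map that vanishes as soon as one argument lies in `ker g` only depends on the
images of its arguments under `g`. -/
lemma AlternatingMap.eq_of_vanish_ker {M Q ι : Type*} [AddCommGroup M] [Module k M]
    [AddCommGroup Q] [Module k Q] [Fintype ι] [DecidableEq ι] (φ : V [⋀^ι]→ₗ[k] Q) (g : V →ₗ[k] M)
    (h : ∀ v i, g (v i) = 0 → φ v = 0) {v w : ι → V} (hvw : ∀ i, g (v i) = g (w i)) :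
    φ v = φ w := by
  have := φ.toMultilinearMap.map_add_univ w (v - w)
  rw [add_sub_cancel, Finset.sum_eq_single Finset.univ] at this
  · simpa using this
  · intro s _ hs
    obtain ⟨i, hi⟩ : ∃ i, i ∉ s := by simpa [Finset.ext_iff] using hs
    exact h _ i (by simp [hi, hvw])
  · simp

/-- Two-variable descent of an alternating map: the first variable is restricted along `f`, the
second is descended along the surjection `g`. -/
lemma AlternatingMap.exists_descend_sum {Q ι κ : Type*} [AddCommGroup Q] [Module k Q]
    [Fintype κ] [DecidableEq ι] [DecidableEq κ] (φ : V [⋀^ι ⊕ κ]→ₗ[k] Q)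
    (f : V' →ₗ[k] V) {g : V →ₗ[k] V''} (hg : Function.Surjective g)
    (h : ∀ (a : ι → V') (b : κ → V) i, g (b i) = 0 → φ (Sum.elim (f ∘ a) b) = 0) :
    ∃ ψ : V' [⋀^ι]→ₗ[k] (V'' [⋀^κ]→ₗ[k] Q),
      ∀ a b, ψ a (g ∘ b) = φ (Sum.elim (f ∘ a) b) := by
  let Φ (a : ι → V') : V [⋀^κ]→ₗ[k] Q :=
    { toFun b := φ (Sum.elim (f ∘ a) b)
      map_update_add' b i x y := by
        simp_rw [← Sum.update_elim_inr, φ.map_update_add]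
      map_update_smul' b i c x := by
        simp_rw [← Sum.update_elim_inr, φ.map_update_smul]
      map_eq_zero_of_eq' b i j hb hij :=
        φ.map_eq_zero_of_eq (i := Sum.inr i) (j := Sum.inr j) _ hb (by simpa using hij) }
  have key (a : ι → V') {b c : κ → V} (hbc : ∀ i, g (b i) = g (c i)) : Φ a b = Φ a c :=
    (Φ a).eq_of_vanish_ker g (fun v i => h a v i) hbc
  obtain ⟨s, hs⟩ := hg.hasRightInverse
  let Ψ (a : ι → V') : V'' [⋀^κ]→ₗ[k] Q :=
    { toFun b := Φ a (s ∘ b)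
      map_update_add' b i x y := by
        have := (Φ a).map_update_add (s ∘ b) i (s x) (s y)
        simp only [Function.comp_update]
        rw [← this]
        exact key a fun j => by by_cases hj : j = i <;> simp [hj, hs _]
      map_update_smul' b i c x := by
        have := (Φ a).map_update_smul (s ∘ b) i c (s x)
        simp only [Function.comp_update]
        rw [← this]
        exact key a fun j => by by_cases hj : j = i <;> simp [hj, hs _]
      map_eq_zero_of_eq' b i j hb hij :=
        (Φ a).map_eq_zero_of_eq (s ∘ b) (by simp [hb]) hij }
  refine ⟨{ toFun := Ψ
            map_update_add' a i x y := ?_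
            map_update_smul' a i c x := ?_
            map_eq_zero_of_eq' a i j ha hij := ?_ }, fun a b => key a fun i => hs _⟩
  · ext b
    change φ _ = φ _ + φ _
    simp_rw [Function.comp_update, ← Sum.update_elim_inl, map_add, φ.map_update_add]
  · ext b
    change φ _ = c • φ _
    simp_rw [Function.comp_update, ← Sum.update_elim_inl, map_smul, φ.map_update_smul]
  · ext b
    exact φ.map_eq_zero_of_eq (i := Sum.inl i) (j := Sum.inl j) _ (by simp [ha])
      (by simpa using hij)

/-- If `χ` kills the entries of `a`, only the identity shuffle contributes to `φ ∧ χ`. -/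
lemma AlternatingMap.domCoprod_elim_of_vanish {N₁ N₂ ι κ : Type*} [AddCommGroup N₁] [Module k N₁]
    [AddCommGroup N₂] [Module k N₂] [Fintype ι] [Fintype κ] [DecidableEq ι] [DecidableEq κ]
    (φ : V [⋀^ι]→ₗ[k] N₁) (χ : V [⋀^κ]→ₗ[k] N₂) (a : ι → V) (b : κ → V)
    (h : ∀ v i j, v i = a j → χ v = 0) :
    φ.domCoprod χ (Sum.elim a b) = φ a ⊗ₜ χ b := by
  rw [AlternatingMap.domCoprod_apply, sum_apply]
  refine (Finset.sum_eq_single (Quotient.mk'' 1 : Equiv.Perm.ModSumCongr ι κ) ?_ ?_).trans ?_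
  · intro σ _ hσ
    induction σ using Quotient.inductionOn' with | _ σ
    have : ∃ i j, σ (Sum.inr i) = Sum.inl j := by
      by_contra! hc
      refine hσ (Quotient.sound' (QuotientGroup.leftRel_apply.2 ?_))
      rw [mul_one]
      refine Equiv.Perm.mem_sumCongrHom_range_of_perm_mapsTo_inl ?_
      rintro _ ⟨j, rfl⟩
      rcases hx : σ⁻¹ (Sum.inl j) with j' | i
      · exact ⟨j', rfl⟩
      · exact absurd (Equiv.Perm.inv_eq_iff_eq.1 hx).symm (hc i j)
    obtain ⟨i, j, hij⟩ := this
    rw [domCoprod.summand_mk'']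
    have := h (fun i => Sum.elim a b (σ (Sum.inr i))) i j (by simp [hij])
    simp [this]
  · simp
  · simp [domCoprod.summand_mk'', Equiv.Perm.sign_one]

/-- Induction over the spanning set of pure wedges. -/
lemma exteriorPower.induction_span {M : Type*} [AddCommGroup M] [Module k M] {n : ℕ}
    {motive : ⋀[k]^n M → Prop} (x) (ι : ∀ v, motive (exteriorPower.ιMulti k n v))
    (zero : motive 0) (add : ∀ x y, motive x → motive y → motive (x + y))
    (smul : ∀ (c : k) x, motive x → motive (c • x)) : motive x := by
  have hx : x ∈ Submodule.span k (Set.range (exteriorPower.ιMulti k n (M := M))) := by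
    simp [exteriorPower.ιMulti_span]
  induction hx using Submodule.span_induction with
  | mem x h => obtain ⟨v, rfl⟩ := h; exact ι v
  | zero => exact zero
  | add x y _ _ hx hy => exact add x y hx hy
  | smul c x _ hx => exact smul c x hx

/-- The kernel of the map on exterior powers induced by a surjection. -/
lemma exteriorPower.ker_map_le {g : V →ₗ[k] V''} (hg : Function.Surjective g) (n : ℕ) :
    LinearMap.ker (exteriorPower.map n g) ≤
      Submodule.span k {x | ∃ v i, g (v i) = 0 ∧ exteriorPower.ιMulti k n v = x} := by
  set D := Submodule.span k {x | ∃ v i, g (v i) = 0 ∧ exteriorPower.ιMulti k n v = x}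
  obtain ⟨ψ, hψ⟩ := AlternatingMap.exists_descend_sum (ι := Fin 0) (κ := Fin n)
    ((D.mkQ.compAlternatingMap (exteriorPower.ιMulti k n)).domDomCongr
      (Equiv.emptySum (Fin 0) (Fin n)).symm) (0 : V →ₗ[k] V) hg (fun a b i hi => by
        exact (Submodule.Quotient.mk_eq_zero D).2 (Submodule.subset_span ⟨_, i, hi, rfl⟩))
  have : exteriorPower.alternatingMapLinearEquiv (ψ 0) ∘ₗ exteriorPower.map n g = D.mkQ := by
    ext v
    simpa using! hψ 0 v
  intro x hx
  rw [← Submodule.Quotient.mk_eq_zero D, ← Submodule.mkQ_apply, ← this, LinearMap.comp_apply,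
    LinearMap.mem_ker.1 hx, map_zero]

open Classical in
/-- An element of an exterior power only involves finitely many vectors. -/
lemma exteriorPower.exists_finset_map_eq {P : Type*} [AddCommGroup P] [Module k P] (Q : Type*)
    [AddCommGroup Q] [Module k Q] {n : ℕ} (x : ⋀[k]^n P) :
    ∃ T : Finset P, ∀ r r' : P →ₗ[k] Q, (∀ t ∈ T, r t = r' t) →
      exteriorPower.map n r x = exteriorPower.map n r' x := by
  induction x using exteriorPower.induction_span with
  | ι v =>
    refine ⟨Finset.univ.image v, fun r r' h => ?_⟩
    simp only [exteriorPower.map_apply_ιMulti]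
    congr 1
    ext i
    exact h _ (by simp)
  | zero => exact ⟨∅, by simp⟩
  | add x y hx hy =>
    obtain ⟨T, hT⟩ := hx
    obtain ⟨U, hU⟩ := hy
    refine ⟨T ∪ U, fun r r' h => ?_⟩
    rw [map_add, map_add, hT r r' fun t ht => h t (by simp [ht]),
      hU r r' fun t ht => h t (by simp [ht])]
  | smul c x hx =>
    obtain ⟨T, hT⟩ := hx
    exact ⟨T, fun r r' h => by rw [map_smul, map_smul, hT r r' h]⟩

open Classical in
/-- The vanishing of an element under a surjection only involves finitely many relations. -/
lemma exteriorPower.exists_finset_map_eq_zero {p : V →ₗ[k] V''} (hp : Function.Surjective p)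
    {n : ℕ} {x : ⋀[k]^n V}
    (hx : exteriorPower.map n p x = 0) :
    ∃ T : Finset V, (∀ t ∈ T, p t = 0) ∧ ∀ {Q : Type*} [AddCommGroup Q] [Module k Q] (r : V →ₗ[k] Q),
      (∀ t ∈ T, r t = 0) → exteriorPower.map n r x = 0 := by
  replace hx := exteriorPower.ker_map_le hp n hx
  induction hx using Submodule.span_induction with
  | mem x h =>
    obtain ⟨v, i, hi, rfl⟩ := h
    refine ⟨{v i}, by simpa using hi, fun {Q} _ _ r hr => ?_⟩
    rw [exteriorPower.map_apply_ιMulti]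
    exact (exteriorPower.ιMulti k n).map_coord_zero i (hr _ (by simp))
  | zero => exact ⟨∅, by simp, by simp⟩
  | add x y _ _ hx hy =>
    obtain ⟨T, hT0, hT⟩ := hx
    obtain ⟨U, hU0, hU⟩ := hy
    refine ⟨T ∪ U, fun t ht => (Finset.mem_union.1 ht).elim (hT0 t) (hU0 t), fun {Q} _ _ r h => ?_⟩
    rw [map_add, hT r fun t ht => h t (by simp [ht]),
      hU r fun t ht => h t (by simp [ht]), add_zero]
  | smul c x _ hx =>
    obtain ⟨T, hT0, hT⟩ := hx
    exact ⟨T, hT0, fun {Q} _ _ r h => by rw [map_smul, hT r h, smul_zero]⟩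

open Classical in
/-- Exterior powers preserve injections with flat cokernel. -/
lemma exteriorPower.map_injective_of_flat [Module.Flat k V''] {f : V' →ₗ[k] V} {g : V →ₗ[k] V''}
    (hf : Function.Injective f) (hg : Function.Surjective g)
    (hfg : LinearMap.range f = LinearMap.ker g) (n : ℕ) :
    Function.Injective (exteriorPower.map n f) := by
  rw [injective_iff_map_eq_zero]
  intro x hx
  let p' := Finsupp.linearCombination k (id : V' → V')
  let p := Finsupp.linearCombination k (id : V → V)
  let F := Finsupp.lmapDomain k k f
  have hpF : p ∘ₗ F = f ∘ₗ p' := by ext; simp [p, p', F]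
  obtain ⟨y, rfl⟩ := exteriorPower.map_surjective (n := n)
    (Finsupp.linearCombination_id_surjective k V') x
  rw [← LinearMap.comp_apply, ← exteriorPower.map_comp, ← hpF, exteriorPower.map_comp] at hx
  obtain ⟨T, hT0, hT⟩ := exteriorPower.exists_finset_map_eq_zero
    (Finsupp.linearCombination_id_surjective k V) hx
  obtain ⟨U, hU⟩ := exteriorPower.exists_finset_map_eq V' y
  obtain ⟨r, hr⟩ := Module.Flat.exists_local_lift hf hg hfg p (T ∪ U.image F)
  have hgf (t) : g (f t) = 0 := by
    rw [← LinearMap.mem_ker, ← hfg]; exact ⟨t, rfl⟩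
  rw [← hU (r ∘ₗ F), exteriorPower.map_comp]
  · refine hT r fun t ht => hf ?_
    have := hT0 t ht
    rw [hr t (by simp [ht]) (by simp [p, this]), map_zero]
    exact this
  · intro t ht
    have : p (F t) = f (p' t) := LinearMap.congr_fun hpF t
    refine hf ?_
    rw [LinearMap.comp_apply, hr _ (Finset.mem_union_right _ (Finset.mem_image_of_mem F ht)), this]
    rw [this, hgf]

open Classical in
/-- Exterior powers of flat modules are flat. -/
instance exteriorPower.instFlat {M : Type*} [AddCommGroup M] [Module k M] [Module.Flat k M]
    (n : ℕ) : Module.Flat k (⋀[k]^n M) := by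
  rw [Module.Flat.iff_forall_exists_factorization]
  intro l c x hx
  let p := Finsupp.linearCombination k (id : M → M)
  have hp : Function.Surjective p := Finsupp.linearCombination_id_surjective k M
  obtain ⟨y, rfl⟩ := Module.projective_lifting_property (exteriorPower.map n p) x
    (exteriorPower.map_surjective hp)
  obtain ⟨T, hT0, hT⟩ := exteriorPower.exists_finset_map_eq_zero hp hx
  choose U hU using fun i => exteriorPower.exists_finset_map_eq M (y (Finsupp.single i 1))
  obtain ⟨m, e, a, b, hab, h⟩ :=
    Module.Flat.exists_factorization_finsupp p (T ∪ Finset.univ.biUnion U)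
  have hy : (exteriorPower.map n a ∘ₗ y) c = 0 :=
    hT a fun t ht => (h t (by simp [ht])).2 (hT0 t ht)
  obtain ⟨l', a', b', hab', ha'⟩ := Module.Flat.iff_forall_exists_factorization.1
    (inferInstance : Module.Flat k (⋀[k]^n (Fin m →₀ k))) hy
  refine ⟨l', a', exteriorPower.map n b ∘ₗ b', ?_, ha'⟩
  rw [LinearMap.comp_assoc, ← hab', ← LinearMap.comp_assoc, ← exteriorPower.map_comp, ← hab]
  ext i : 2
  refine hU i _ _ fun t ht => ?_
  rw [LinearMap.comp_apply, (h t ?_).1]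
  simp only [Finset.mem_union, Finset.mem_biUnion, Finset.mem_univ, true_and]
  exact Or.inr ⟨i, ht⟩

end

/-- Given a short exact sequence `0 → V' → V → V'' → 0` of modules over a commutative
ring `k` (with `V''` flat), for each `j ≥ 0` the exterior power `⋀^j V` admits a
filtration `0 = N 0 ⊆ N 1 ⊆ ... ⊆ N (j+1) = ⋀^j V` (with `N (i+1)` playing the role of
`M_i`, `i = -1, 0, ..., j`) whose subquotients satisfy
`N (i+1) / N i ≅ ⋀^{j-i} V' ⊗ ⋀^i V''`; the subquotient isomorphism is expressed by a
surjective linear map `N (i+1) → ⋀^{j-i} V' ⊗ ⋀^i V''` with kernel `N i`. -/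
theorem stmt_4 {k : Type*} [CommRing k] {V' V V'' : Type*}
    [AddCommGroup V'] [Module k V'] [AddCommGroup V] [Module k V]
    [AddCommGroup V''] [Module k V''] [Module.Flat k V'']
    (f : V' →ₗ[k] V) (g : V →ₗ[k] V'')
    (hf : Function.Injective f) (hg : Function.Surjective g)
    (hfg : LinearMap.range f = LinearMap.ker g) (j : ℕ) :
    ∃ N : ℕ → Submodule k ↥(⋀[k]^j V), Monotone N ∧ N 0 = ⊥ ∧ N (j + 1) = ⊤ ∧
      ∀ i ≤ j, ∃ π : ↥(N (i + 1)) →ₗ[k] ((⋀[k]^(j - i) V') ⊗[k] (⋀[k]^i V'')),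
        Function.Surjective π ∧
          LinearMap.ker π = (N i).comap (N (i + 1)).subtype := by
  have hgf (t) : g (f t) = 0 := by rw [← LinearMap.mem_ker, ← hfg]; exact ⟨t, rfl⟩
  let N (n : ℕ) : Submodule k (⋀[k]^j V) := Submodule.span k {x | ∃ (w : Fin j → V)
    (S : Finset (Fin j)), j < S.card + n ∧ (∀ l ∈ S, w l ∈ LinearMap.range f) ∧
      exteriorPower.ιMulti k j w = x}
  have hNmono : Monotone N := fun n n' h => Submodule.span_mono
    fun x ⟨w, S, hS, hw⟩ => ⟨w, S, by omega, hw⟩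
  refine ⟨N, hNmono, ?_, ?_, fun i hi => ?_⟩
  · refine Submodule.span_eq_bot.2 fun x ⟨w, S, hS, _⟩ => ?_
    have := S.card_le_univ
    simp only [Fintype.card_fin] at this
    omega
  · rw [eq_top_iff, ← exteriorPower.ιMulti_span]
    refine Submodule.span_mono ?_
    rintro _ ⟨w, rfl⟩
    exact ⟨w, ∅, by simp, by simp, rfl⟩
  obtain ⟨m, rfl⟩ : ∃ m, j = m + i := ⟨j - i, by omega⟩
  rw [Nat.add_sub_cancel]
  let e₀ : Fin m ⊕ Fin i ≃ Fin (m + i) := finSumFinEquiv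
  let Φ := (exteriorPower.ιMulti k (m + i) (M := V)).domDomCongr e₀.symm
  have hΦN (n) (v) (S : Finset (Fin m ⊕ Fin i)) (hS : m + i < S.card + n)
      (hv : ∀ l ∈ S, v l ∈ LinearMap.range f) : Φ v ∈ N n :=
    Submodule.subset_span ⟨v ∘ e₀.symm, S.map e₀.toEmbedding, by simpa using hS,
      fun l hl => by
        obtain ⟨x, hx, rfl⟩ := Finset.mem_map.1 hl
        simpa using hv x hx, rfl⟩
  have hgen (w : Fin (m + i) → V) (S : Finset (Fin (m + i))) (hS : m + i < S.card + (i + 1))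
      (hw : ∀ l ∈ S, w l ∈ LinearMap.range f) : ∃ (a : Fin m → V') (b : Fin i → V) (c : k),
      exteriorPower.ιMulti k (m + i) w = c • Φ (Sum.elim (f ∘ a) b) ∧
        (m + i < S.card + i → ∃ l, g (b l) = 0) := by
    obtain ⟨S', hS', hcard⟩ := Finset.exists_subset_card_eq (show m ≤ S.card by omega)
    have hcard' : S'ᶜ.card = i := by simp [Finset.card_compl, hcard]
    let e := finSumEquivOfFinset hcard hcard'
    have he (l) : e (Sum.inl l) ∈ S' := by simp [e]
    choose a ha using fun l => hw _ (hS' (he l))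
    refine ⟨a, w ∘ e ∘ Sum.inr, ((Equiv.Perm.sign (e₀.symm.trans e) : ℤ) : k), ?_, fun h => ?_⟩
    · have hwe : Sum.elim (f ∘ a) (w ∘ e ∘ Sum.inr) = w ∘ e := by
        ext (l | l) <;> simp [ha]
      have := (exteriorPower.ιMulti k (m + i)).map_perm w (e₀.symm.trans e)
      change Φ (w ∘ e) = _ at this
      rw [hwe, this]
      rcases Int.units_eq_one_or (Equiv.Perm.sign (e₀.symm.trans e)) with h | h <;> simp [h]
    · obtain ⟨x, hx, hx'⟩ := Finset.exists_mem_notMem_of_card_lt_card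
        (show S'.card < S.card by omega)
      obtain ⟨l, rfl⟩ : ∃ l, e (Sum.inr l) = x := by
        rcases h : e.symm x with l | l
        · exact absurd (by simpa [← h] using he l) hx'
        · exact ⟨l, by simp [← h]⟩
      refine ⟨l, ?_⟩
      obtain ⟨t, ht⟩ := hw _ hx
      simp [← ht, hgf]
  let Ω := ((exteriorPower.ιMulti k m (M := V)).domCoprod
    ((exteriorPower.ιMulti k i (M := V'')).compLinearMap g)).domDomCongr e₀
  let Δ := exteriorPower.alternatingMapLinearEquiv (R := k) (M := V)
    (N := (⋀[k]^m V) ⊗[k] (⋀[k]^i V'')) Ω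
  have hΔ (a : Fin m → V') (b : Fin i → V) : Δ (Φ (Sum.elim (f ∘ a) b)) =
      exteriorPower.ιMulti k m (f ∘ a) ⊗ₜ exteriorPower.ιMulti k i (g ∘ b) := by
    have : Δ (Φ (Sum.elim (f ∘ a) b)) = (exteriorPower.ιMulti k m (M := V)).domCoprod
        ((exteriorPower.ιMulti k i (M := V'')).compLinearMap g) (Sum.elim (f ∘ a) b) := by
      refine (exteriorPower.alternatingMapLinearEquiv_apply_ιMulti _ _).trans ?_
      simp only [Ω, AlternatingMap.domDomCongr_apply]
      congr 1
      ext l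
      simp
    rw [this, AlternatingMap.domCoprod_elim_of_vanish]
    · rfl
    · intro v l l' h
      exact (exteriorPower.ιMulti k i).map_coord_zero l (by simp [h, hgf])
  let ρ := (exteriorPower.map m f).rTensor (⋀[k]^i V'')
  have hρ : Function.Injective ρ := Module.Flat.rTensor_preserves_injective_linearMap _
    (exteriorPower.map_injective_of_flat hf hg hfg m)
  obtain ⟨ψ, hψ⟩ := AlternatingMap.exists_descend_sum ((N i).mkQ.compAlternatingMap Φ) f hg
    fun a b l hl => (Submodule.Quotient.mk_eq_zero (N i)).2 <| by
      refine hΦN i _ (insert (Sum.inr l) (Finset.univ.map Function.Embedding.inl)) ?_ ?_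
      · rw [Finset.card_insert_of_notMem (by simp)]
        simp
      · have : b l ∈ LinearMap.range f := by rwa [hfg, LinearMap.mem_ker]
        simpa using this
  let θ : (⋀[k]^m V') ⊗[k] (⋀[k]^i V'') →ₗ[k] (⋀[k]^(m + i) V) ⧸ N i :=
    TensorProduct.lift <| exteriorPower.alternatingMapLinearEquiv <|
      exteriorPower.alternatingMapLinearEquiv.toLinearMap.compAlternatingMap ψ
  have hθ (a : Fin m → V') (b : Fin i → V) : θ (exteriorPower.ιMulti k m a ⊗ₜ
      exteriorPower.ιMulti k i (g ∘ b)) = (N i).mkQ (Φ (Sum.elim (f ∘ a) b)) := by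
    simpa [θ] using hψ a b
  have hρι (a : Fin m → V') (b : Fin i → V) : ρ (exteriorPower.ιMulti k m a ⊗ₜ
      exteriorPower.ιMulti k i (g ∘ b)) = Δ (Φ (Sum.elim (f ∘ a) b)) := by
    simp [ρ, hΔ]
  have hlift (z) (hz : z ∈ N (i + 1)) : ∃ t, ρ t = Δ z ∧ θ t = (N i).mkQ z := by
    induction hz using Submodule.span_induction with
    | mem z h =>
      obtain ⟨w, S, hS, hw, rfl⟩ := h
      obtain ⟨a, b, c, h, -⟩ := hgen w S hS hw
      refine ⟨c • (exteriorPower.ιMulti k m a ⊗ₜ exteriorPower.ιMulti k i (g ∘ b)), ?_, ?_⟩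
      · rw [h, map_smul, map_smul, hρι]
      · rw [h, map_smul, map_smul, hθ]
    | zero => exact ⟨0, by simp⟩
    | add x y _ _ hx hy =>
      obtain ⟨t, ht, ht'⟩ := hx
      obtain ⟨u, hu, hu'⟩ := hy
      exact ⟨t + u, by simp only [map_add, ht, hu], by simp only [map_add, ht', hu']⟩
    | smul c x _ hx =>
      obtain ⟨t, ht, ht'⟩ := hx
      exact ⟨c • t, by simp only [map_smul, ht], by simp only [map_smul, ht']⟩
  have hker : N i ≤ LinearMap.ker Δ := by
    refine Submodule.span_le.2 ?_
    rintro _ ⟨w, S, hS, hw, rfl⟩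
    obtain ⟨a, b, c, h, h'⟩ := hgen w S (by omega) hw
    obtain ⟨l, hl⟩ := h' hS
    have : exteriorPower.ιMulti k i (g ∘ b) = 0 :=
      (exteriorPower.ιMulti k i).map_coord_zero l hl
    rw [SetLike.mem_coe, LinearMap.mem_ker, h, map_smul, hΔ, this, TensorProduct.tmul_zero,
      smul_zero]
  have hrange : LinearMap.range ρ ≤ (N (i + 1)).map Δ := by
    rintro _ ⟨t, rfl⟩
    induction t with
    | zero => simp
    | add x y hx hy => rw [map_add]; exact add_mem hx hy
    | tmul x y =>
      induction x using exteriorPower.induction_span with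
      | zero => simp
      | add x y hx hy => rw [TensorProduct.add_tmul, map_add]; exact add_mem hx hy
      | smul c x hx =>
        rw [← TensorProduct.smul_tmul', map_smul]; exact Submodule.smul_mem _ _ hx
      | ι a =>
        induction y using exteriorPower.induction_span with
        | zero => simp
        | add x y hx hy => rw [TensorProduct.tmul_add, map_add]; exact add_mem hx hy
        | smul c x hx => rw [TensorProduct.tmul_smul, map_smul]; exact Submodule.smul_mem _ _ hx
        | ι b =>
          obtain ⟨b, rfl⟩ := hg.comp_left b
          rw [hρι]
          refine Submodule.mem_map_of_mem
            (hΦN _ _ (Finset.univ.map Function.Embedding.inl) (by simp) (by simp))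
  let E := LinearEquiv.ofInjective ρ hρ
  let D : N (i + 1) →ₗ[k] LinearMap.range ρ := (Δ ∘ₗ (N (i + 1)).subtype).codRestrict _
    fun z => let ⟨t, ht, _⟩ := hlift z z.2; ⟨t, ht⟩
  have hD : Function.Surjective D := fun ⟨y, hy⟩ =>
    let ⟨z, hz, hzy⟩ := hrange hy; ⟨⟨z, hz⟩, Subtype.ext hzy⟩
  refine ⟨E.symm.toLinearMap ∘ₗ D, E.symm.surjective.comp hD, ?_⟩
  rw [LinearEquiv.ker_comp, LinearMap.ker_codRestrict, LinearMap.ker_comp]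
  refine le_antisymm (fun z hz => ?_) (Submodule.comap_mono hker)
  obtain ⟨t, ht, ht'⟩ := hlift z z.2
  have hz : Δ z = 0 := hz
  rw [hz, map_eq_zero_iff ρ hρ] at ht
  rw [ht, map_zero] at ht'
  exact (Submodule.Quotient.mk_eq_zero (N i)).1 ht'.symm
end

section
/- Let D be a triangulated category with a bounded co-t-structure whose coheart S is Krull–Schmidt. Suppose δ: D^op → D is a triangulated antiautoequivalence and ⟦1⟧: D → D an autoequivalence commuting with the triangulated structure, such that δ ∘ ⟦1⟧ ≅ ⟦-1⟧ ∘ δ, S is stable under δ and ⟦1⟧, and for each indecomposable S ∈ S there is a unique n ∈ ℤ with δ(S⟦n⟧) ≅ S⟦n⟧. Then S is the unique silting subcategory of D with these properties: any other silting subcategory S' satisfying the same three conditions equals S. -/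
open CategoryTheory CategoryTheory.Limits CategoryTheory.Pretriangulated ZeroObject

/-- A co-t-structure on a triangulated category `C`: a pair `(ge, le)` of classes of
objects (`ge` playing the role of `T_{≥0}` and `le` of `T_{≤0}`), closed under direct
summands, with `T_{≥0}[-1] ⊆ T_{≥0}`, `T_{≤0}[1] ⊆ T_{≤0}`,
`Hom(T_{≥0}[-1], T_{≤0}) = 0`, and such that every object `X` fits into a distinguished
triangle `A → X → B → A[1]` with `A ∈ T_{≥0}[-1]` and `B ∈ T_{≤0}`. -/
structure CoTStructure (C : Type*) [Category C] [Preadditive C] [HasZeroObject C]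
    [HasShift C ℤ] [∀ n : ℤ, (CategoryTheory.shiftFunctor C n).Additive]
    [Pretriangulated C] where
  ge : Set C
  le : Set C
  ge_summand : ∀ {X Y : C}, X ∈ ge → (∃ (i : Y ⟶ X) (r : X ⟶ Y), i ≫ r = 𝟙 Y) → Y ∈ ge
  le_summand : ∀ {X Y : C}, X ∈ le → (∃ (i : Y ⟶ X) (r : X ⟶ Y), i ≫ r = 𝟙 Y) → Y ∈ le
  ge_shift : ∀ X ∈ ge, X⟦(-1 : ℤ)⟧ ∈ ge
  le_shift : ∀ X ∈ le, X⟦(1 : ℤ)⟧ ∈ le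
  hom_zero : ∀ X : _, X⟦(1 : ℤ)⟧ ∈ ge → ∀ Y ∈ le, ∀ f : X ⟶ Y, f = 0
  exists_triangle : ∀ X : C, ∃ (A B : C) (f : A ⟶ X) (g : X ⟶ B) (h : B ⟶ A⟦(1 : ℤ)⟧),
    A⟦(1 : ℤ)⟧ ∈ ge ∧ B ∈ le ∧ Triangle.mk f g h ∈ distinguishedTriangles

variable {C : Type*} [Category C] [Preadditive C] [HasZeroObject C]
    [HasShift C ℤ] [∀ n : ℤ, (CategoryTheory.shiftFunctor C n).Additive]
    [Pretriangulated C]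

/-- A co-t-structure is bounded if every object lies in some `T_{≥n}` and some
`T_{≤m}` (where `X ∈ T_{≥n} ↔ X⟦n⟧ ∈ T_{≥0}` and `X ∈ T_{≤m} ↔ X⟦m⟧ ∈ T_{≤0}`). -/
def CoTStructure.bounded (t : CoTStructure C) : Prop :=
  ∀ X : C, (∃ n : ℤ, X⟦n⟧ ∈ t.ge) ∧ (∃ n : ℤ, X⟦n⟧ ∈ t.le)

/-- The coheart of a co-t-structure. -/
def CoTStructure.coheart (t : CoTStructure C) : Set C := t.ge ∩ t.le

variable [HasBinaryBiproducts C] [HasFiniteBiproducts C]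

section
variable (tw : ℤ → (C ≌ C)) (δ : Cᵒᵖ ⥤ C)

/-- The three conditions of the uniqueness lemma for a class `S'` of objects:
(1) stability under the Tate twist `⟦1⟧` and the antiautoequivalence `δ`;
(2) `S'` is Krull–Schmidt: every object of `S'` is a finite direct sum of objects of
`S'` with local endomorphism rings;
(3) for each indecomposable `S₀ ∈ S'` there is a unique `n : ℤ` with
`δ(S₀⟦n⟧) ≅ S₀⟦n⟧`. -/
def DualityConditions (S' : Set C) : Prop :=
  (∀ X ∈ S', (tw 1).functor.obj X ∈ S' ∧ δ.obj (Opposite.op X) ∈ S') ∧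
  (∀ X ∈ S', ∃ (n : ℕ) (g : Fin n → C),
    (∀ i, g i ∈ S' ∧ IsLocalRing (End (g i))) ∧ Nonempty (X ≅ ⨁ g)) ∧
  (∀ X ∈ S', IsLocalRing (End X) →
    ∃! n : ℤ, Nonempty (δ.obj (Opposite.op ((tw n).functor.obj X)) ≅ (tw n).functor.obj X))

/-- `S'` is a silting subcategory: a full additive subcategory (closed under
isomorphisms, zero, finite direct sums and direct summands) with
`Hom(S, S'[k]) = 0` for `k > 0`, generating `C` as a triangulated category. -/
def IsSiltingSubcat (S' : Set C) : Prop :=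
  (∀ {X Y : C}, X ∈ S' → Nonempty (X ≅ Y) → Y ∈ S') ∧
  (0 : C) ∈ S' ∧
  (∀ X ∈ S', ∀ Y ∈ S', (X ⊞ Y) ∈ S') ∧
  (∀ {X Y : C}, X ∈ S' → (∃ (i : Y ⟶ X) (r : X ⟶ Y), i ≫ r = 𝟙 Y) → Y ∈ S') ∧
  (∀ X ∈ S', ∀ Y ∈ S', ∀ k : ℤ, 0 < k → ∀ f : X ⟶ Y⟦k⟧, f = 0) ∧
  (∀ P : Set C, S' ⊆ P →
    (∀ {X Y : C}, X ∈ P → Nonempty (X ≅ Y) → Y ∈ P) →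
    (∀ X ∈ P, X⟦(1 : ℤ)⟧ ∈ P ∧ X⟦(-1 : ℤ)⟧ ∈ P) →
    (∀ T ∈ (distinguishedTriangles : Set (Triangle C)),
      T.obj₁ ∈ P → T.obj₃ ∈ P → T.obj₂ ∈ P) →
    ∀ X : C, X ∈ P)

end

set_option linter.unusedSectionVars false

namespace SiltingDuality

section Triangles

variable {X Y Z : C} {f : X ⟶ Y} {g : Y ⟶ Z} {h : Z ⟶ X⟦(1 : ℤ)⟧}

lemma dist_comp₁₂ (hT : Triangle.mk f g h ∈ distinguishedTriangles) : f ≫ g = 0 :=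
  comp_distTriang_mor_zero₁₂ _ hT

lemma dist_comp₂₃ (hT : Triangle.mk f g h ∈ distinguishedTriangles) : g ≫ h = 0 :=
  comp_distTriang_mor_zero₂₃ _ hT

lemma dist_comp₃₁ (hT : Triangle.mk f g h ∈ distinguishedTriangles) : h ≫ f⟦(1 : ℤ)⟧' = 0 :=
  comp_distTriang_mor_zero₃₁ _ hT

lemma dist_lift₂ (hT : Triangle.mk f g h ∈ distinguishedTriangles) {W : C} (a : W ⟶ Y)
    (ha : a ≫ g = 0) : ∃ b : W ⟶ X, b ≫ f = a := by
  obtain ⟨b, hb⟩ := Triangle.coyoneda_exact₂ _ hT a ha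
  exact ⟨b, hb.symm⟩

lemma dist_lift₃ (hT : Triangle.mk f g h ∈ distinguishedTriangles) {W : C} (a : W ⟶ Z)
    (ha : a ≫ h = 0) : ∃ b : W ⟶ Y, b ≫ g = a := by
  obtain ⟨b, hb⟩ := Triangle.coyoneda_exact₃ _ hT a ha
  exact ⟨b, hb.symm⟩

lemma dist_lift_shift₁ (hT : Triangle.mk f g h ∈ distinguishedTriangles) {W : C}
    (a : W ⟶ X⟦(1 : ℤ)⟧) (ha : a ≫ f⟦(1 : ℤ)⟧' = 0) : ∃ b : W ⟶ Z, b ≫ h = a := by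
  obtain ⟨b, hb⟩ := Triangle.coyoneda_exact₁ _ hT a ha
  exact ⟨b, hb.symm⟩

lemma dist_lift_shift₂ (hT : Triangle.mk f g h ∈ distinguishedTriangles) {W : C}
    (a : W ⟶ Y⟦(1 : ℤ)⟧) (ha : a ≫ g⟦(1 : ℤ)⟧' = 0) :
    ∃ b : W ⟶ X⟦(1 : ℤ)⟧, b ≫ f⟦(1 : ℤ)⟧' = a := by
  obtain ⟨b, hb⟩ := Triangle.coyoneda_exact₁ _ (rot_of_distTriang _ hT) a ha
  exact ⟨-b, by rw [hb]; exact (Preadditive.neg_comp _ _).trans (Preadditive.comp_neg _ _).symm⟩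

lemma dist_desc₂ (hT : Triangle.mk f g h ∈ distinguishedTriangles) {W : C} (a : Y ⟶ W)
    (ha : f ≫ a = 0) : ∃ b : Z ⟶ W, g ≫ b = a := by
  obtain ⟨b, hb⟩ := Triangle.yoneda_exact₂ _ hT a ha
  exact ⟨b, hb.symm⟩

lemma dist_desc₃ (hT : Triangle.mk f g h ∈ distinguishedTriangles) {W : C} (a : Z ⟶ W)
    (ha : g ≫ a = 0) : ∃ b : X⟦(1 : ℤ)⟧ ⟶ W, h ≫ b = a := by
  obtain ⟨b, hb⟩ := Triangle.yoneda_exact₃ _ hT a ha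
  exact ⟨b, hb.symm⟩

lemma dist_desc_shift₁ (hT : Triangle.mk f g h ∈ distinguishedTriangles) {W : C}
    (a : X⟦(1 : ℤ)⟧ ⟶ W) (ha : h ≫ a = 0) :
    ∃ b : Y⟦(1 : ℤ)⟧ ⟶ W, f⟦(1 : ℤ)⟧' ≫ b = a := by
  obtain ⟨b, hb⟩ := Triangle.yoneda_exact₃ _ (rot_of_distTriang _ hT) a ha
  exact ⟨-b, by rw [hb]; exact (Preadditive.comp_neg _ _).trans (Preadditive.neg_comp _ _).symm⟩

/-- Completion of a morphism of distinguished triangles at the middle object. -/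
lemma dist_complete₂ {A₁ A A₃ : C} {i : A₁ ⟶ A} {q : A ⟶ A₃} {l : A₃ ⟶ A₁⟦(1 : ℤ)⟧}
    (hA : Triangle.mk i q l ∈ distinguishedTriangles)
    (hT : Triangle.mk f g h ∈ distinguishedTriangles) (a : A₁ ⟶ X) (c : A₃ ⟶ Z)
    (hac : l ≫ a⟦(1 : ℤ)⟧' = c ≫ h) : ∃ b : A ⟶ Y, i ≫ b = a ≫ f ∧ q ≫ c = b ≫ g := by
  obtain ⟨b, hb, hb'⟩ := complete_distinguished_triangle_morphism₂ _ _ hA hT a c hac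
  exact ⟨b, hb, hb'⟩

end Triangles

section Shifts

/-- `X⟦m⟧⟦n⟧ ≅ X⟦k⟧` whenever `m + n = k`. -/
lemma nonempty_shift_add (X : C) {m n k : ℤ} (h : m + n = k) :
    Nonempty (X⟦m⟧⟦n⟧ ≅ X⟦k⟧) :=
  ⟨((shiftFunctorAdd' C m n k h).app X).symm⟩

lemma nonempty_shift_zero (X : C) {n : ℤ} (h : n = 0) : Nonempty (X⟦n⟧ ≅ X) := by
  subst h
  exact ⟨shiftZero ℤ X⟩

lemma nonempty_shift_cancel (X : C) {m n : ℤ} (h : m + n = 0) : Nonempty (X⟦m⟧⟦n⟧ ≅ X) :=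
  (nonempty_shift_add X h).map2 (· ≪≫ ·) (nonempty_shift_zero X rfl)

lemma nonempty_map_iso {D E : Type*} [Category D] [Category E] (F : D ⥤ E) {X Y : D}
    (h : Nonempty (X ≅ Y)) : Nonempty (F.obj X ≅ F.obj Y) := h.map F.mapIso

lemma nonempty_iso_trans {D : Type*} [Category D] {X Y Z : D} (h : Nonempty (X ≅ Y))
    (h' : Nonempty (Y ≅ Z)) : Nonempty (X ≅ Z) := h.map2 (· ≪≫ ·) h'

lemma nonempty_iso_symm {D : Type*} [Category D] {X Y : D} (h : Nonempty (X ≅ Y)) :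
    Nonempty (Y ≅ X) := h.map Iso.symm

lemma eq_zero_of_shift_eq_zero {X Y : C} (n : ℤ) {f : X ⟶ Y} (h : f⟦n⟧' = 0) : f = 0 :=
  (shiftFunctor C n).map_injective (by rw [h, Functor.map_zero])

/-- Vanishing of all morphisms between two objects transfers along isomorphisms. -/
lemma hom_zero_of_iso {D : Type*} [Category D] [HasZeroMorphisms D] {X X' Y Y' : D}
    (hX : Nonempty (X ≅ X')) (hY : Nonempty (Y ≅ Y')) (h : ∀ f : X' ⟶ Y', f = 0) (f : X ⟶ Y) :
    f = 0 := by
  obtain ⟨e⟩ := hX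
  obtain ⟨e'⟩ := hY
  have := h (e.inv ≫ f ≫ e'.hom)
  rw [← cancel_mono e'.hom, ← cancel_epi e.inv, this]
  simp

lemma hom_zero_of_shift {X Y : C} (n : ℤ) (h : ∀ f : X⟦n⟧ ⟶ Y⟦n⟧, f = 0) (f : X ⟶ Y) : f = 0 :=
  eq_zero_of_shift_eq_zero n (h _)

end Shifts

section CoTStructureLemmas

variable (t : CoTStructure C)

lemma mem_ge_of_iso {X Y : C} (h : Nonempty (X ≅ Y)) (hX : X ∈ t.ge) : Y ∈ t.ge := by
  obtain ⟨e⟩ := h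
  exact t.ge_summand hX ⟨e.inv, e.hom, e.inv_hom_id⟩

lemma mem_le_of_iso {X Y : C} (h : Nonempty (X ≅ Y)) (hX : X ∈ t.le) : Y ∈ t.le := by
  obtain ⟨e⟩ := h
  exact t.le_summand hX ⟨e.inv, e.hom, e.inv_hom_id⟩

lemma shift_mem_ge {W : C} (h : ∀ Y ∈ t.le, ∀ f : W ⟶ Y, f = 0) : W⟦(1 : ℤ)⟧ ∈ t.ge := by
  obtain ⟨A, B, f, g, k, hA, hB, hT⟩ := t.exists_triangle W
  obtain ⟨s, hs⟩ := dist_lift₂ hT (𝟙 W) (by rw [h B hB g, comp_zero])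
  exact t.ge_summand hA ⟨s⟦(1 : ℤ)⟧', f⟦(1 : ℤ)⟧', by
    rw [← Functor.map_comp, hs, CategoryTheory.Functor.map_id]⟩

lemma mem_le_of_hom_zero {Y : C} (h : ∀ X : C, X⟦(1 : ℤ)⟧ ∈ t.ge → ∀ f : X ⟶ Y, f = 0) :
    Y ∈ t.le := by
  obtain ⟨A, B, f, g, k, hA, hB, hT⟩ := t.exists_triangle Y
  obtain ⟨s, hs⟩ := dist_desc₂ hT (𝟙 Y) (by rw [h A hA f, zero_comp])
  exact t.le_summand hB ⟨g, s, hs⟩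

lemma shift_neg_one_shift_mem_ge {W : C} (hW : W ∈ t.ge) : W⟦(-1 : ℤ)⟧⟦(1 : ℤ)⟧ ∈ t.ge :=
  mem_ge_of_iso t (nonempty_iso_symm (nonempty_shift_cancel W (by norm_num))) hW

lemma mem_ge_of_hom_zero {W : C} (h : ∀ Y ∈ t.le, ∀ f : W ⟶ Y⟦(1 : ℤ)⟧, f = 0) : W ∈ t.ge := by
  refine mem_ge_of_iso t (nonempty_shift_cancel W (show (-1 : ℤ) + 1 = 0 by norm_num))
    (shift_mem_ge t fun Y hY => hom_zero_of_shift 1 ?_)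
  exact hom_zero_of_iso (nonempty_shift_cancel W (by norm_num)) ⟨Iso.refl _⟩ (h Y hY)

lemma shift_neg_mem_ge {W : C} (hW : W ∈ t.ge) (n : ℕ) : W⟦(-n : ℤ)⟧ ∈ t.ge := by
  induction n with
  | zero => exact mem_ge_of_iso t (nonempty_iso_symm (nonempty_shift_zero W (by simp))) hW
  | succ n ih =>
    exact mem_ge_of_iso t (nonempty_shift_add W (by push_cast; ring)) (t.ge_shift _ ih)

lemma shift_mem_le {Y : C} (hY : Y ∈ t.le) (n : ℕ) : Y⟦(n : ℤ)⟧ ∈ t.le := by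
  induction n with
  | zero => exact mem_le_of_iso t (nonempty_iso_symm (nonempty_shift_zero Y (by simp))) hY
  | succ n ih => exact mem_le_of_iso t (nonempty_shift_add Y (by push_cast; ring)) (t.le_shift _ ih)

lemma hom_zero_shift_one {W Y : C} (hW : W ∈ t.ge) (hY : Y ∈ t.le) (f : W ⟶ Y⟦(1 : ℤ)⟧) :
    f = 0 := by
  refine hom_zero_of_shift (-1) ?_ f
  exact hom_zero_of_iso ⟨Iso.refl _⟩ (nonempty_shift_cancel Y (by norm_num))
    (t.hom_zero _ (shift_neg_one_shift_mem_ge t hW) Y hY)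

lemma hom_zero_shift {W Y : C} (hW : W ∈ t.ge) (hY : Y ∈ t.le) {k : ℤ} (hk : 0 < k)
    (f : W ⟶ Y⟦k⟧) : f = 0 := by
  obtain ⟨n, rfl⟩ : ∃ n : ℕ, k = n + 1 := ⟨(k - 1).toNat, by omega⟩
  exact hom_zero_of_iso ⟨Iso.refl _⟩ (nonempty_iso_symm (nonempty_shift_add Y rfl))
    (hom_zero_shift_one t hW (shift_mem_le t hY n)) f

/-- Every object of `t.ge` admits a left `t.le`-approximation by an object of the coheart. -/
lemma exists_coheart_approx {W : C} (hW : W ∈ t.ge) :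
    ∃ c ∈ t.coheart, ∃ p : W ⟶ c, ∀ Z ∈ t.le, ∀ f : W ⟶ Z, ∃ f' : c ⟶ Z, p ≫ f' = f := by
  obtain ⟨A, B, f, g, k, hA, hB, hT⟩ := t.exists_triangle W
  refine ⟨B, ⟨mem_ge_of_hom_zero t fun Y hY b => ?_, hB⟩, g, fun Z hZ φ =>
    dist_desc₂ hT φ (t.hom_zero A hA Z hZ _)⟩
  obtain ⟨c, rfl⟩ := dist_desc₃ hT b (hom_zero_shift_one t hW hY _)
  rw [hom_zero_shift_one t hA hY c, comp_zero]

/-- An object `Y` with a positive shift in `t.le` lies in `t.le` as soon as it receives no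
morphism from the negative shifts of the coheart. -/
lemma mem_le_of_coheart_hom_zero (ht : t.bounded) {Y : C}
    (h : ∀ s ∈ t.coheart, ∀ j : ℕ, 0 < j → ∀ f : s ⟶ Y⟦(j : ℤ)⟧, f = 0) : Y ∈ t.le := by
  have key : ∀ m : ℕ, Y⟦(m : ℤ)⟧ ∈ t.le → Y ∈ t.le := by
    intro m
    induction m with
    | zero => exact mem_le_of_iso t (nonempty_shift_zero Y (by simp))
    | succ m ih =>
      intro hm
      apply ih
      obtain ⟨A, B, f, g, k, hA, hB, hT⟩ := t.exists_triangle (Y⟦(m : ℤ)⟧)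
      have hm' : Y⟦(m : ℤ)⟧⟦(1 : ℤ)⟧ ∈ t.le :=
        mem_le_of_iso t (nonempty_iso_symm (nonempty_shift_add Y (by push_cast; ring))) hm
      have hA' : A⟦(1 : ℤ)⟧ ∈ t.le := by
        refine mem_le_of_hom_zero t fun X hX a => ?_
        obtain ⟨b, rfl⟩ := dist_lift_shift₁ hT a (t.hom_zero X hX _ hm' _)
        rw [t.hom_zero X hX _ hB b, zero_comp]
      have hf : f⟦(1 : ℤ)⟧' = 0 :=
        hom_zero_of_iso ⟨Iso.refl _⟩ (nonempty_shift_add Y (by push_cast; ring))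
          (h _ ⟨hA, hA'⟩ (m + 1) m.succ_pos) _
      obtain ⟨s, hs⟩ := dist_desc₂ hT (𝟙 _)
        (by rw [eq_zero_of_shift_eq_zero 1 hf, zero_comp])
      exact t.le_summand hB ⟨g, s, hs⟩
  obtain ⟨n, hn⟩ := (ht Y).2
  refine key n.toNat ?_
  exact mem_le_of_iso t (nonempty_shift_add Y (by omega))
    (shift_mem_le t hn (n.toNat - n).toNat)

lemma biproduct_mem_coheart {n : ℕ} (g : Fin n → C)
    (hg : ∀ i, g i ∈ t.coheart) : (⨁ g) ∈ t.coheart := by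
  constructor
  · refine mem_ge_of_hom_zero t fun Y hY f => biproduct.hom_ext' _ _ fun i => ?_
    rw [hom_zero_shift_one t (hg i).1 hY (biproduct.ι g i ≫ f), comp_zero]
  · refine mem_le_of_hom_zero t fun X hX f => biproduct.hom_ext _ _ fun i => ?_
    rw [t.hom_zero X hX _ (hg i).2 (f ≫ biproduct.π g i), zero_comp]

end CoTStructureLemmas


section Generation

variable (t : CoTStructure C)

/-- A morphism `f : A ⟶ Y` with `A` in `t.ge` which behaves like the truncation of `Y` for the
co-t-structure: morphisms from `t.ge` lift along `f`, and uniquely so after one shift. -/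
structure IsTruncation {A Y : C} (f : A ⟶ Y) : Prop where
  mem : A ∈ t.ge
  lift : ∀ W ∈ t.ge, ∀ a : W ⟶ Y, ∃ b : W ⟶ A, b ≫ f = a
  inj : ∀ W ∈ t.ge, ∀ a : W ⟶ A⟦(1 : ℤ)⟧, a ≫ f⟦(1 : ℤ)⟧' = 0 → a = 0

/-- `Y` has a truncation whose left `t.le`-approximation can be chosen in `S'`. -/
def HasTruncationIn (S' : Set C) (Y : C) : Prop :=
  ∃ (A : C) (f : A ⟶ Y), IsTruncation t f ∧ ∃ c ∈ S', ∃ p : A ⟶ c,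
    ∀ Z ∈ t.le, ∀ φ : A ⟶ Z, ∃ φ' : c ⟶ Z, p ≫ φ' = φ

variable {t}

lemma HasTruncationIn.of_iso {S' : Set C} {Y Y' : C} (h : HasTruncationIn t S' Y)
    (e : Nonempty (Y ≅ Y')) : HasTruncationIn t S' Y' := by
  obtain ⟨A, f, hf, hc⟩ := h
  obtain ⟨e⟩ := e
  refine ⟨A, f ≫ e.hom, ⟨hf.mem, fun W hW a => ?_, fun W hW a ha => hf.inj W hW a ?_⟩, hc⟩
  · obtain ⟨b, hb⟩ := hf.lift W hW (a ≫ e.inv)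
    exact ⟨b, by rw [← Category.assoc, hb]; simp⟩
  · rw [Functor.map_comp, ← Category.assoc] at ha
    rw [← cancel_mono (e.hom⟦(1 : ℤ)⟧'), ha, zero_comp]

lemma IsTruncation.lift_shift {A Y : C} {f : A ⟶ Y} (hf : IsTruncation t f) {W : C}
    (hW : W ∈ t.ge) (a : W ⟶ Y⟦(1 : ℤ)⟧) : ∃ b : W ⟶ A⟦(1 : ℤ)⟧, b ≫ f⟦(1 : ℤ)⟧' = a := by
  obtain ⟨e⟩ := nonempty_shift_cancel W (show (-1 : ℤ) + 1 = 0 by norm_num)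
  obtain ⟨a', ha'⟩ := (shiftFunctor C (1 : ℤ)).map_surjective (e.hom ≫ a)
  obtain ⟨b, rfl⟩ := hf.lift _ (t.ge_shift W hW) a'
  refine ⟨e.inv ≫ b⟦(1 : ℤ)⟧', ?_⟩
  rw [Category.assoc, ← Functor.map_comp, ha', Iso.inv_hom_id_assoc]

lemma HasTruncationIn.ext {S' : Set C} (hadd : ∀ X ∈ S', ∀ Y ∈ S', (X ⊞ Y) ∈ S')
    (hS' : S' ⊆ t.le) {X Y Z : C} {u : X ⟶ Y} {v : Y ⟶ Z} {w : Z ⟶ X⟦(1 : ℤ)⟧}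
    (hT : Triangle.mk u v w ∈ distinguishedTriangles) (hX : HasTruncationIn t S' X)
    (hZ : HasTruncationIn t S' Z) : HasTruncationIn t S' Y := by
  obtain ⟨A₁, f₁, hf₁, c₁, hc₁, p₁, hp₁⟩ := hX
  obtain ⟨A₃, f₃, hf₃, c₃, hc₃, p₃, hp₃⟩ := hZ
  obtain ⟨l, hl⟩ := hf₁.lift_shift hf₃.mem (f₃ ≫ w)
  obtain ⟨A, i, q, hA⟩ := distinguished_cocone_triangle₂ l
  obtain ⟨f, hif, hqf⟩ := dist_complete₂ hA hT f₁ f₃ hl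
  refine ⟨A, f, ⟨mem_ge_of_hom_zero t fun L hL b => ?_, fun W hW a => ?_, fun W hW a ha => ?_⟩,
    c₁ ⊞ c₃, hadd _ hc₁ _ hc₃, ?_⟩
  · obtain ⟨b', rfl⟩ := dist_desc₂ hA b (hom_zero_shift_one t hf₁.mem hL _)
    rw [hom_zero_shift_one t hf₃.mem hL b', comp_zero]
  · obtain ⟨b, hb⟩ := hf₃.lift W hW (a ≫ v)
    have hbl : b ≫ l = 0 := hf₁.inj W hW _ (by
      rw [Category.assoc, hl, ← Category.assoc, hb, Category.assoc, dist_comp₂₃ hT, comp_zero])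
    obtain ⟨b', rfl⟩ := dist_lift₃ hA b hbl
    obtain ⟨d, hd⟩ := dist_lift₂ hT (a - b' ≫ f) (by
      rw [Preadditive.sub_comp, ← hb, Category.assoc, Category.assoc, hqf, sub_self])
    obtain ⟨d', rfl⟩ := hf₁.lift W hW d
    refine ⟨b' + d' ≫ i, ?_⟩
    rw [Preadditive.add_comp, Category.assoc, hif, ← Category.assoc, hd, add_sub_cancel]
  · have haq : a ≫ q⟦(1 : ℤ)⟧' = 0 := hf₃.inj W hW _ (by
      rw [Category.assoc, ← Functor.map_comp, hqf, Functor.map_comp, ← Category.assoc, ha,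
        zero_comp])
    obtain ⟨d, rfl⟩ := dist_lift_shift₂ hA a haq
    obtain ⟨e, he⟩ := dist_lift_shift₁ hT (d ≫ f₁⟦(1 : ℤ)⟧') (by
      rw [Category.assoc, ← Functor.map_comp, ← hif, Functor.map_comp, ← Category.assoc, ha])
    obtain ⟨e', rfl⟩ := hf₃.lift W hW e
    have hd : d - e' ≫ l = 0 := hf₁.inj W hW _ (by
      rw [Preadditive.sub_comp, ← he, Category.assoc, Category.assoc, hl, sub_self])
    rw [sub_eq_zero.1 hd, Category.assoc, dist_comp₃₁ hA, comp_zero]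
  · obtain ⟨r', hr'⟩ := dist_desc_shift₁ hA (p₁⟦(1 : ℤ)⟧')
      (hom_zero_shift_one t hf₃.mem (hS' hc₁) _)
    obtain ⟨r, rfl⟩ := (shiftFunctor C (1 : ℤ)).map_surjective r'
    rw [← Functor.map_comp] at hr'
    have hr : i ≫ r = p₁ := (shiftFunctor C (1 : ℤ)).map_injective hr'
    refine ⟨biprod.lift r (q ≫ p₃), fun L hL φ => ?_⟩
    obtain ⟨g, hg⟩ := hp₁ L hL (i ≫ φ)
    obtain ⟨k, hk⟩ := dist_desc₂ hA (φ - r ≫ g) (by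
      rw [Preadditive.comp_sub, ← Category.assoc, hr, hg, sub_self])
    obtain ⟨k', rfl⟩ := hp₃ L hL k
    exact ⟨biprod.desc g k', by rw [biprod.lift_desc, Category.assoc, hk, add_sub_cancel]⟩

/-- A silting subcategory contained in the coheart of a co-t-structure is the whole coheart. -/
lemma coheart_subset_of_isSiltingSubcat {S' : Set C} (hS' : IsSiltingSubcat S')
    (h : S' ⊆ t.coheart) : t.coheart ⊆ S' := by
  obtain ⟨-, hzero, hadd, hsummand, -, hgen⟩ := hS'
  have key : ∀ X : C, ∀ n : ℤ, HasTruncationIn t S' (X⟦n⟧) := by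
    refine hgen {X | ∀ n : ℤ, HasTruncationIn t S' (X⟦n⟧)} (fun s hs n => ?_)
      (fun hX e n => (hX n).of_iso (nonempty_map_iso _ e))
      (fun X hX => ⟨fun n => (hX (1 + n)).of_iso (nonempty_iso_symm (nonempty_shift_add X rfl)),
        fun n => (hX (-1 + n)).of_iso (nonempty_iso_symm (nonempty_shift_add X rfl))⟩)
      (fun T hT h₁ h₃ n => HasTruncationIn.ext hadd (fun s hs => (h hs).2)
        (Triangle.shift_distinguished T hT n) (h₁ n) (h₃ n))
    have hid : ∀ {Y : C}, Y ∈ t.ge → IsTruncation t (𝟙 Y) := fun {Y} hY =>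
      ⟨hY, fun W hW a => ⟨a, Category.comp_id a⟩, fun W hW a ha => by simpa using ha⟩
    rcases lt_trichotomy n 0 with hn | rfl | hn
    · obtain ⟨m, rfl⟩ : ∃ m : ℕ, n = -((m + 1 : ℕ) : ℤ) := ⟨(-n - 1).toNat, by omega⟩
      refine ⟨_, 𝟙 _, hid (shift_neg_mem_ge t (h hs).1 _), 0, hzero, 0, fun Z hZ φ => ⟨0, ?_⟩⟩
      rw [t.hom_zero _ (mem_ge_of_iso t (nonempty_iso_symm (nonempty_shift_add s
        (by push_cast; ring))) (shift_neg_mem_ge t (h hs).1 m)) Z hZ φ, comp_zero]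
    · refine HasTruncationIn.of_iso ?_ (nonempty_iso_symm (nonempty_shift_zero s rfl))
      exact ⟨s, 𝟙 s, hid (h hs).1, s, hs, 𝟙 s, fun Z _ φ => ⟨φ, Category.id_comp φ⟩⟩
    · refine ⟨0, 0, ⟨(h hzero).1, fun W hW a => ⟨0, ?_⟩, fun W hW a _ => ?_⟩, 0, hzero, 0,
        fun Z hZ φ => ⟨0, ?_⟩⟩
      · rw [hom_zero_shift t hW (h hs).2 hn a, zero_comp]
      · exact hom_zero_shift_one t hW (h hzero).2 a
      · rw [zero_comp, (isZero_zero C).eq_of_src φ 0]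
  intro M hM
  obtain ⟨A, f, hf, c, hc, p, hp⟩ := (key M 0).of_iso (nonempty_shift_zero M rfl)
  obtain ⟨b, hb⟩ := hf.lift M hM.1 (𝟙 M)
  obtain ⟨f', rfl⟩ := hp M hM.2 f
  exact hsummand hc ⟨b ≫ p, f', by rw [Category.assoc, hb]⟩

end Generation


section LocalEndomorphisms

/-- The endomorphism ring of `X` is local, phrased in terms of isomorphisms. -/
def HasLocalEnd {D : Type*} [Category D] [Preadditive D] (X : D) : Prop :=
  𝟙 X ≠ 0 ∧ ∀ a : X ⟶ X, IsIso a ∨ IsIso (𝟙 X - a)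

/-- Every nonzero morphism out of `M` is a split monomorphism. -/
def Isolated {D : Type*} [Category D] [HasZeroMorphisms D] (M : D) : Prop :=
  ∀ ⦃Y : D⦄ (f : M ⟶ Y), f ≠ 0 → ∃ r : Y ⟶ M, f ≫ r = 𝟙 M

section

variable {D E : Type*} [Category D] [Category E]

lemma exists_retraction_of_map (F : D ⥤ E) [F.Full] [F.Faithful] {X Y : D} {f : X ⟶ Y}
    (h : ∃ r, F.map f ≫ r = 𝟙 (F.obj X)) : ∃ r, f ≫ r = 𝟙 X := by
  obtain ⟨r, hr⟩ := h
  obtain ⟨r, rfl⟩ := F.map_surjective r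
  exact ⟨r, F.map_injective (by rw [F.map_comp, hr, F.map_id])⟩

variable [Preadditive D] [Preadditive E]

lemma HasLocalEnd.of_isLocalRing {X : D} (h : IsLocalRing (End X)) : HasLocalEnd X := by
  refine ⟨fun h0 => ?_, fun a => ?_⟩
  · exact one_ne_zero (α := End X) h0
  · rcases IsLocalRing.isUnit_or_isUnit_of_add_one (R := End X) (a := a) (b := 𝟙 X - a)
      (add_sub_cancel _ _) with h | h
    · exact Or.inl ((isUnit_iff_isIso _).1 h)
    · exact Or.inr ((isUnit_iff_isIso _).1 h)

lemma HasLocalEnd.isIso_or_isIso {X : D} (h : HasLocalEnd X) {a b : X ⟶ X} (hab : a + b = 𝟙 X) :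
    IsIso a ∨ IsIso b := by
  obtain rfl : b = 𝟙 X - a := eq_sub_of_add_eq' hab
  exact h.2 a

lemma HasLocalEnd.isIso_or_isIso_or_isIso {X : D} (h : HasLocalEnd X) {a b c : X ⟶ X}
    (habc : a + b + c = 𝟙 X) : IsIso a ∨ IsIso b ∨ IsIso c := by
  rcases h.isIso_or_isIso habc with hab | hc
  · let d := inv (a + b)
    have hd : a ≫ d + b ≫ d = 𝟙 X := by rw [← Preadditive.add_comp, IsIso.hom_inv_id]
    rcases h.isIso_or_isIso hd with h' | h'
    · exact Or.inl (IsIso.of_isIso_comp_right a d)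
    · exact Or.inr (Or.inl (IsIso.of_isIso_comp_right b d))
  · exact Or.inr (Or.inr hc)

lemma HasLocalEnd.isIso_of_retraction {X Y : D} (hX : 𝟙 X ≠ 0) (hY : HasLocalEnd Y) {i : X ⟶ Y}
    {r : Y ⟶ X} (h : i ≫ r = 𝟙 X) : IsIso i := by
  rcases hY.2 (r ≫ i) with h' | h'
  · have : r ≫ i = 𝟙 Y := by
      rw [← cancel_epi (r ≫ i), Category.assoc, reassoc_of% h, Category.comp_id]
    exact ⟨r, h, this⟩
  · refine absurd ?_ hX
    have : i = 0 := by
      rw [← cancel_mono (𝟙 Y - r ≫ i), Preadditive.comp_sub, reassoc_of% h, Category.comp_id,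
        sub_self, zero_comp]
    rw [← h, this, zero_comp]

lemma HasLocalEnd.map (F : D ⥤ E) [F.Full] [F.Faithful] [F.Additive] {X : D} (h : HasLocalEnd X) :
    HasLocalEnd (F.obj X) := by
  refine ⟨fun h0 => h.1 (F.map_injective (by rw [F.map_id, h0, F.map_zero])), fun a => ?_⟩
  obtain ⟨a, rfl⟩ := F.map_surjective a
  rcases h.2 a with h' | h'
  · exact Or.inl inferInstance
  · right
    rw [← F.map_id, ← F.map_sub]
    infer_instance

lemma Isolated.of_iso {X Y : D} (h : Isolated X) (e : Nonempty (X ≅ Y)) : Isolated Y := by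
  obtain ⟨e⟩ := e
  intro Z f hf
  obtain ⟨r, hr⟩ := h (e.hom ≫ f) fun h0 => hf (by rw [← cancel_epi e.hom, h0, comp_zero])
  exact ⟨r ≫ e.hom, by rw [← cancel_epi e.hom, ← Category.assoc, ← Category.assoc, hr]; simp⟩

lemma Isolated.map (F : D ⥤ E) [F.IsEquivalence] [F.Additive] {X : D} (h : Isolated X) :
    Isolated (F.obj X) := by
  intro Z f hf
  let e := F.objObjPreimageIso Z
  obtain ⟨g, hg⟩ := F.map_surjective (f ≫ e.inv)
  obtain ⟨r, hr⟩ := h g fun h0 => hf (by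
    rw [← cancel_mono e.inv, ← hg, h0, F.map_zero, zero_comp])
  exact ⟨e.inv ≫ F.map r, by rw [← Category.assoc, ← hg, ← F.map_comp, hr, F.map_id]⟩

lemma Isolated.of_map (F : D ⥤ E) [F.Full] [F.Faithful] [F.Additive] {X : D}
    (h : Isolated (F.obj X)) : Isolated X := fun _ f hf =>
  exists_retraction_of_map F (h (F.map f) fun h0 => hf (F.map_injective (by rw [h0, F.map_zero])))

/-- A nonzero morphism from an isolated object to an object with local endomorphisms is an
isomorphism. -/
lemma Isolated.isIso {M X : D} (hM : Isolated M) (hX : HasLocalEnd X) {f : M ⟶ X} (hf : f ≠ 0) :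
    IsIso f := by
  obtain ⟨r, hr⟩ := hM f hf
  exact HasLocalEnd.isIso_of_retraction
    (fun h0 => hf (by rw [← Category.id_comp f, h0, zero_comp])) hX hr

end

lemma Isolated.exists_section {M Y : C} (hM : Isolated M) {f : Y ⟶ M} (hf : f ≠ 0) :
    ∃ s : M ⟶ Y, s ≫ f = 𝟙 M := by
  obtain ⟨Z, g, h, hT⟩ := distinguished_cocone_triangle f
  by_cases hg : g = 0
  · exact dist_lift₂ hT (𝟙 M) (by rw [hg, comp_zero])
  · obtain ⟨r, hr⟩ := hM g hg
    refine absurd ?_ hf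
    rw [← Category.comp_id f, ← hr, ← Category.assoc, dist_comp₁₂ hT, zero_comp]

lemma Isolated.of_hom_to {M X : C} (hM : Isolated M) (hX : HasLocalEnd X) {f : X ⟶ M}
    (hf : f ≠ 0) : Isolated X := by
  obtain ⟨s, hs⟩ := hM.exists_section hf
  have : IsIso s := HasLocalEnd.isIso_of_retraction
    (fun h0 => hf (by rw [← Category.comp_id f, h0, comp_zero])) hX hs
  exact hM.of_iso ⟨asIso s⟩

lemma Isolated.of_hom_from {M X : C} (hM : Isolated M) (hX : HasLocalEnd X) {f : M ⟶ X}
    (hf : f ≠ 0) : Isolated X :=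
  have := hM.isIso hX hf
  hM.of_iso ⟨asIso f⟩

/-- An additive autoequivalence commutes with the shift on objects with local endomorphisms that
are not isolated, even without any compatibility with triangles. -/
lemma nonempty_map_shift_one_iso (F : C ⥤ C) [F.IsEquivalence] [F.Additive] {M : C}
    (hM : HasLocalEnd M) (hM' : ¬ Isolated M) :
    Nonempty (F.obj (M⟦(1 : ℤ)⟧) ≅ (F.obj M)⟦(1 : ℤ)⟧) := by
  obtain ⟨Y, f, hf, hf'⟩ : ∃ (Y : C) (f : M ⟶ Y), f ≠ 0 ∧ ¬ ∃ r : Y ⟶ M, f ≫ r = 𝟙 M := by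
    simpa [Isolated] using hM'
  obtain ⟨Z, g, h, hT⟩ := distinguished_cocone_triangle f
  obtain ⟨Z', g', c, hT'⟩ := distinguished_cocone_triangle (F.map f)
  have hγ : ∀ {V : C} (x : F.obj Y ⟶ V), F.map f ≫ x = 0 → ∃ y, F.map g ≫ y = x := by
    intro V x hx
    let e := F.objObjPreimageIso V
    obtain ⟨x', hx'⟩ := F.map_surjective (x ≫ e.inv)
    obtain ⟨y, hy⟩ := dist_desc₂ hT x' (F.map_injective (by
      rw [F.map_comp, hx', reassoc_of% hx, zero_comp, F.map_zero]))
    exact ⟨F.map y ≫ e.hom, by rw [← Category.assoc, ← F.map_comp, hy, hx']; simp⟩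
  have hc : ∀ {V : C} (x : F.obj Z ⟶ V), F.map g ≫ x = 0 → ∃ y, F.map h ≫ y = x := by
    intro V x hx
    let e := F.objObjPreimageIso V
    obtain ⟨x', hx'⟩ := F.map_surjective (x ≫ e.inv)
    obtain ⟨y, hy⟩ := dist_desc₃ hT x' (F.map_injective (by
      rw [F.map_comp, hx', reassoc_of% hx, zero_comp, F.map_zero]))
    exact ⟨F.map y ≫ e.hom, by rw [← Category.assoc, ← F.map_comp, hy, hx']; simp⟩
  obtain ⟨a, ha⟩ := dist_desc₂ hT' (F.map g) (by rw [← F.map_comp, dist_comp₁₂ hT, F.map_zero])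
  obtain ⟨b, hb⟩ := hγ g' (dist_comp₁₂ hT')
  obtain ⟨u, hu⟩ := dist_desc₃ hT' (a ≫ F.map h) (by
    rw [← Category.assoc, ha, ← F.map_comp, dist_comp₂₃ hT, F.map_zero])
  obtain ⟨v, hv⟩ := hc (b ≫ c) (by rw [← Category.assoc, hb, dist_comp₂₃ hT'])
  obtain ⟨y, hy⟩ := dist_desc₃ hT' (𝟙 _ - a ≫ b) (by
    rw [Preadditive.comp_sub, ← Category.assoc, ha, hb, Category.comp_id, sub_self])
  obtain ⟨z, hz⟩ := dist_desc_shift₁ hT' (𝟙 _ - u ≫ v - y ≫ c) (by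
    rw [Preadditive.comp_sub, Preadditive.comp_sub, ← Category.assoc, ← Category.assoc, hu, hy,
      Category.assoc, hv, Preadditive.sub_comp, Category.comp_id, Category.id_comp,
      Category.assoc, sub_self])
  have hN : HasLocalEnd ((F.obj M)⟦(1 : ℤ)⟧) := (hM.map F).map (shiftFunctor C (1 : ℤ))
  have hN' : HasLocalEnd (F.obj (M⟦(1 : ℤ)⟧)) := (hM.map (shiftFunctor C (1 : ℤ))).map F
  have hsum : u ≫ v + y ≫ c + (F.map f)⟦(1 : ℤ)⟧' ≫ z = 𝟙 _ := by rw [hz]; abel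
  rcases hN.isIso_or_isIso_or_isIso hsum with h' | h' | h'
  · have : IsIso u := HasLocalEnd.isIso_of_retraction hN.1 hN' (r := v ≫ inv (u ≫ v))
      (by rw [← Category.assoc, IsIso.hom_inv_id])
    exact ⟨(asIso u).symm⟩
  · refine absurd ?_ hf
    apply F.map_injective
    rw [F.map_zero]
    apply eq_zero_of_shift_eq_zero 1
    rw [← cancel_epi (y ≫ c), Category.assoc, dist_comp₃₁ hT', comp_zero, comp_zero]
  · refine absurd ?_ hf'
    refine exists_retraction_of_map F (exists_retraction_of_map (shiftFunctor C (1 : ℤ))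
      ⟨z ≫ inv ((F.map f)⟦(1 : ℤ)⟧' ≫ z), ?_⟩)
    rw [← Category.assoc, IsIso.hom_inv_id]

lemma nonempty_map_shift_neg_one_iso (F : C ⥤ C) [F.IsEquivalence] [F.Additive] {M : C}
    (hM : HasLocalEnd M) (hM' : ¬ Isolated M) :
    Nonempty (F.obj (M⟦(-1 : ℤ)⟧) ≅ (F.obj M)⟦(-1 : ℤ)⟧) := by
  have h := nonempty_map_shift_one_iso F (hM.map (shiftFunctor C (-1 : ℤ)))
    fun h => hM' (h.of_map (shiftFunctor C (-1 : ℤ)))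
  have h' := nonempty_iso_trans (nonempty_iso_symm h)
    (nonempty_map_iso F (nonempty_shift_cancel M (show (-1 : ℤ) + 1 = 0 by norm_num)))
  exact nonempty_iso_trans (nonempty_iso_symm (nonempty_shift_cancel _ (by norm_num)))
    (nonempty_map_iso (shiftFunctor C (-1 : ℤ)) h')

lemma nonempty_map_shift_neg_iso (F : C ⥤ C) [F.IsEquivalence] [F.Additive] {M : C}
    (hM : HasLocalEnd M) (hM' : ¬ Isolated M) (j : ℕ) :
    Nonempty (F.obj (M⟦(-j : ℤ)⟧) ≅ (F.obj M)⟦(-j : ℤ)⟧) := by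
  induction j with
  | zero =>
    exact nonempty_iso_trans (nonempty_map_iso F (nonempty_shift_zero M (by simp)))
      (nonempty_iso_symm (nonempty_shift_zero _ (by simp)))
  | succ j ih =>
    have h := nonempty_map_shift_neg_one_iso F (hM.map (shiftFunctor C (-j : ℤ)))
      fun h => hM' (h.of_map (shiftFunctor C (-j : ℤ)))
    have e : ∀ X : C, Nonempty (X⟦(-j : ℤ)⟧⟦(-1 : ℤ)⟧ ≅ X⟦(-(j + 1 : ℕ) : ℤ)⟧) := fun X =>
      nonempty_shift_add X (by push_cast; ring)
    exact nonempty_iso_trans (nonempty_map_iso F (nonempty_iso_symm (e M)))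
      (nonempty_iso_trans h (nonempty_iso_trans
        (nonempty_map_iso (shiftFunctor C (-1 : ℤ)) ih) (e _)))

end LocalEndomorphisms

section MinimalComponent

variable (t : CoTStructure C)

/-- An object `W` of `t.ge` with `W⟦1⟧` not in `t.ge` has an indecomposable component `x : W ⟶ M`
of its minimal left approximation by the coheart. -/
lemma exists_minimal_component
    (hKS : ∀ X ∈ t.coheart, ∃ (n : ℕ) (g : Fin n → C),
      (∀ i, g i ∈ t.coheart ∧ IsLocalRing (End (g i))) ∧ Nonempty (X ≅ ⨁ g))
    {W : C} (hW : W ∈ t.ge) (hW' : W⟦(1 : ℤ)⟧ ∉ t.ge) :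
    ∃ M ∈ t.coheart, IsLocalRing (End M) ∧ ∃ x : W ⟶ M, x ≠ 0 ∧
      (∀ c ∈ t.coheart, ∀ (q : W ⟶ c) (r : c ⟶ M), q ≫ r = x → ∃ s, s ≫ r = 𝟙 M) ∧
      (∀ Z ∈ t.le, ∀ y : M ⟶ Z, x ≫ y = 0 → ∃ c ∈ t.coheart, ∃ (r : M ⟶ c) (γ : c ⟶ Z),
        r ≫ γ = y ∧ ¬ ∃ s, r ≫ s = 𝟙 M) := by
  classical
  have hex : ∃ (N : ℕ) (g : Fin N → C), (∀ i, g i ∈ t.coheart ∧ IsLocalRing (End (g i))) ∧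
      ∃ p : W ⟶ ⨁ g, ∀ Z ∈ t.le, ∀ f : W ⟶ Z, ∃ f' : ⨁ g ⟶ Z, p ≫ f' = f := by
    obtain ⟨c, hc, p, hp⟩ := exists_coheart_approx t hW
    obtain ⟨N, g, hg, ⟨e⟩⟩ := hKS c hc
    refine ⟨N, g, hg, p ≫ e.hom, fun Z hZ f => ?_⟩
    obtain ⟨f', rfl⟩ := hp Z hZ f
    exact ⟨e.inv ≫ f', by simp⟩
  obtain ⟨g, hg, p, hp⟩ := Nat.find_spec hex
  have hmin := fun m (hm : m < Nat.find hex) => Nat.find_min hex hm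
  generalize Nat.find hex = N at g hg p hp hmin
  cases N with
  | zero =>
    refine absurd (shift_mem_ge t fun Z hZ f => ?_) hW'
    obtain ⟨f', rfl⟩ := hp Z hZ f
    rw [show f' = 0 from biproduct.hom_ext' _ _ fun i => i.elim0, comp_zero]
  | succ N =>
    have hB : (⨁ g) ∈ t.coheart := biproduct_mem_coheart t g fun i => (hg i).1
    obtain ⟨A, a, w, hT⟩ := distinguished_cocone_triangle₁ p
    have hA : A⟦(1 : ℤ)⟧ ∈ t.ge := shift_mem_ge t fun Z hZ f => by
      obtain ⟨b, hb⟩ := dist_desc_shift₁ hT (f⟦(1 : ℤ)⟧') (hom_zero_shift_one t hB.1 hZ _)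
      obtain ⟨b, rfl⟩ := (shiftFunctor C (1 : ℤ)).map_surjective b
      obtain ⟨b', rfl⟩ := hp Z hZ b
      rw [← Functor.map_comp, ← Category.assoc, dist_comp₁₂ hT, zero_comp, Functor.map_zero] at hb
      exact eq_zero_of_shift_eq_zero 1 hb.symm
    have hsplit : ¬ ∃ ρ, (biproduct.ι g 0 ≫ w) ≫ ρ = 𝟙 (g 0) := by
      rintro ⟨ρ, hρ⟩
      let g' : Fin N → C := fun i => g i.succ
      let d : ⨁ g ⟶ ⨁ g' := biproduct.lift fun i => biproduct.π g i.succ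
      let d' : ⨁ g' ⟶ ⨁ g := biproduct.desc fun i => biproduct.ι g i.succ
      have hd₀ : biproduct.ι g 0 ≫ d = 0 := biproduct.hom_ext _ _ fun i => by
        simp [d, g', biproduct.ι_π_ne g (Fin.succ_ne_zero i).symm]
      have hd : ∀ i : Fin N, biproduct.ι g i.succ ≫ d = biproduct.ι g' i := fun i =>
        biproduct.hom_ext _ _ fun j => by
          by_cases hij : i = j
          · subst hij
            simp [d, g']
          · simp [d, g', biproduct.ι_π_ne g (fun h => hij (Fin.succ_injective _ h)),
              biproduct.ι_π_ne g' hij]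
      refine hmin N N.lt_succ_self ⟨g', fun i => hg i.succ, p ≫ d, fun Z hZ f => ?_⟩
      obtain ⟨f', rfl⟩ := hp Z hZ f
      let f'' : ⨁ g ⟶ Z := f' - w ≫ ρ ≫ biproduct.ι g 0 ≫ f'
      have h₀ : biproduct.ι g 0 ≫ f'' = 0 := by
        simp only [f'', Preadditive.comp_sub]
        simp only [← Category.assoc]
        rw [hρ, Category.id_comp, sub_self]
      have h₁ : d ≫ d' ≫ f'' = f'' := biproduct.hom_ext' _ _ fun i => by
        refine Fin.cases ?_ (fun i => ?_) i
        · rw [reassoc_of% hd₀, zero_comp, h₀]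
        · rw [reassoc_of% (hd i)]
          simp [d', g']
      refine ⟨d' ≫ f'', ?_⟩
      rw [Category.assoc, h₁]
      simp only [f'', Preadditive.comp_sub]
      rw [← Category.assoc p w, dist_comp₂₃ hT, zero_comp, sub_zero]
    have hfac : ∀ c ∈ t.coheart, ∀ (q : W ⟶ c) (r : c ⟶ g 0), q ≫ r = p ≫ biproduct.π g 0 →
        ∃ s, s ≫ r = 𝟙 (g 0) := by
      intro c hc q r hqr
      obtain ⟨q', rfl⟩ := hp c hc.2 q
      obtain ⟨h, hh⟩ := dist_desc₃ hT (biproduct.π g 0 - q' ≫ r) (by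
        rw [Preadditive.comp_sub, ← hqr, Category.assoc, sub_self])
      have hsum : biproduct.ι g 0 ≫ q' ≫ r + biproduct.ι g 0 ≫ w ≫ h = 𝟙 (g 0) := by
        rw [hh, Preadditive.comp_sub, biproduct.ι_π_self, add_sub_cancel]
      rcases (HasLocalEnd.of_isLocalRing (hg 0).2).isIso_or_isIso hsum with h' | h'
      · exact ⟨inv (biproduct.ι g 0 ≫ q' ≫ r) ≫ biproduct.ι g 0 ≫ q', by simp⟩
      · exact absurd ⟨h ≫ inv (biproduct.ι g 0 ≫ w ≫ h), by
          rw [← Category.assoc, Category.assoc _ w h, IsIso.hom_inv_id]⟩ hsplit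
    refine ⟨g 0, (hg 0).1, (hg 0).2, p ≫ biproduct.π g 0, fun h0 => ?_, hfac,
      fun Z hZ y hy => ?_⟩
    · obtain ⟨s, hs⟩ := hfac (g 0) (hg 0).1 0 0 (by rw [h0, comp_zero])
      exact (HasLocalEnd.of_isLocalRing (hg 0).2).1 (by rw [← hs, comp_zero])
    · obtain ⟨h, hh⟩ := dist_desc₃ hT (biproduct.π g 0 ≫ y) (by rw [← Category.assoc, hy])
      obtain ⟨c, hc, u, hu⟩ := exists_coheart_approx t hA
      obtain ⟨γ, rfl⟩ := hu Z hZ h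
      refine ⟨c, hc, biproduct.ι g 0 ≫ w ≫ u, γ, ?_, ?_⟩
      · rw [Category.assoc, Category.assoc, hh, ← Category.assoc, biproduct.ι_π_self,
          Category.id_comp]
      · rintro ⟨s, hs⟩
        exact hsplit ⟨u ≫ s, by simpa using hs⟩

end MinimalComponent

section Duality

lemma additive_of_isEquivalence (F : C ⥤ C) [F.IsEquivalence] : F.Additive :=
  Functor.additive_of_preserves_binary_products F

lemma nonempty_op_iso {D E : Type*} [Category D] [Category E] (δ : Dᵒᵖ ⥤ E) {X Y : D}
    (h : Nonempty (X ≅ Y)) :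
    Nonempty (δ.obj (Opposite.op X) ≅ δ.obj (Opposite.op Y)) :=
  h.map fun e => δ.mapIso e.symm.op

/-- A contravariant functor taking one step of a `ℤ`-action to its inverse does so for all
steps. -/
lemma nonempty_op_action_iso (T : ℤ → C ⥤ C) (h0 : ∀ X : C, Nonempty ((T 0).obj X ≅ X))
    (hadd : ∀ (m n : ℤ) (X : C), Nonempty ((T m).obj ((T n).obj X) ≅ (T (m + n)).obj X))
    (δ : Cᵒᵖ ⥤ C)
    (h1 : ∀ X : C, Nonempty (δ.obj (Opposite.op ((T 1).obj X)) ≅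
      (T (-1)).obj (δ.obj (Opposite.op X)))) (n : ℤ) (X : C) :
    Nonempty (δ.obj (Opposite.op ((T n).obj X)) ≅ (T (-n)).obj (δ.obj (Opposite.op X))) := by
  have hnat : ∀ (n : ℕ) (X : C), Nonempty (δ.obj (Opposite.op ((T n).obj X)) ≅
      (T (-n)).obj (δ.obj (Opposite.op X))) := by
    intro n
    induction n with
    | zero =>
      intro X
      have h := nonempty_op_iso δ (h0 X)
      exact nonempty_iso_trans (by simpa using h) (nonempty_iso_symm (by simpa using h0 _))
    | succ n ih =>
      intro X
      have e := nonempty_op_iso δ (nonempty_iso_symm (hadd n 1 X))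
      have e' := hadd (-n) (-1) (δ.obj (Opposite.op X))
      rw [show (-n + -1 : ℤ) = -((n + 1 : ℕ) : ℤ) by push_cast; ring] at e'
      exact nonempty_iso_trans (by exact_mod_cast e) (nonempty_iso_trans (ih _)
        (nonempty_iso_trans (nonempty_map_iso (T (-n)) (h1 X)) e'))
  have hneg : ∀ (n : ℕ) (X : C), Nonempty (δ.obj (Opposite.op ((T (-n)).obj X)) ≅
      (T n).obj (δ.obj (Opposite.op X))) := by
    intro n X
    have e := hnat n ((T (-n)).obj X)
    have e₁ : Nonempty (δ.obj (Opposite.op X) ≅ _) := nonempty_iso_trans (nonempty_op_iso δ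
      (nonempty_iso_symm (nonempty_iso_trans (hadd n (-n) X) (by simpa using h0 X)))) e
    have e₂ := hadd n (-n) (δ.obj (Opposite.op ((T (-n)).obj X)))
    rw [add_neg_cancel] at e₂
    exact nonempty_iso_trans (nonempty_iso_symm (nonempty_iso_trans e₂ (h0 _)))
      (nonempty_map_iso (T n) (nonempty_iso_symm e₁))
  rcases le_total 0 n with h | h
  · obtain ⟨m, rfl⟩ := Int.eq_ofNat_of_zero_le h
    exact hnat m X
  · obtain ⟨m, rfl⟩ : ∃ m : ℕ, n = -m := ⟨(-n).toNat, by omega⟩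
    rw [neg_neg]
    exact hneg m X

/-- `tw` is an action of `ℤ` up to isomorphism, and the contravariant functor `δ` reverses both
the shift and `tw`. -/
structure IsTwistDuality (tw : ℤ → (C ≌ C)) (δ : Cᵒᵖ ⥤ C) : Prop where
  zero : ∀ X : C, Nonempty ((tw 0).functor.obj X ≅ X)
  add : ∀ (m n : ℤ) (X : C),
    Nonempty ((tw m).functor.obj ((tw n).functor.obj X) ≅ (tw (m + n)).functor.obj X)
  shift_one : ∀ X : C,
    Nonempty (δ.obj (Opposite.op (X⟦(1 : ℤ)⟧)) ≅ (δ.obj (Opposite.op X))⟦(-1 : ℤ)⟧)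
  twist_one : ∀ X : C, Nonempty (δ.obj (Opposite.op ((tw 1).functor.obj X)) ≅
    (tw (-1)).functor.obj (δ.obj (Opposite.op X)))

namespace IsTwistDuality

variable {tw : ℤ → (C ≌ C)} {δ : Cᵒᵖ ⥤ C}

lemma cancel (hδ : IsTwistDuality tw δ) {m n : ℤ} (h : m + n = 0) (X : C) :
    Nonempty ((tw m).functor.obj ((tw n).functor.obj X) ≅ X) := by
  have e := hδ.add m n X
  rw [h] at e
  exact nonempty_iso_trans e (hδ.zero X)

lemma shift (hδ : IsTwistDuality tw δ) (n : ℤ) (X : C) :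
    Nonempty (δ.obj (Opposite.op (X⟦n⟧)) ≅ (δ.obj (Opposite.op X))⟦-n⟧) :=
  nonempty_op_action_iso (fun n => shiftFunctor C n) (fun X => nonempty_shift_zero X rfl)
    (fun _ _ X => nonempty_shift_add X (add_comm _ _)) δ hδ.shift_one n X

lemma twist (hδ : IsTwistDuality tw δ) (n : ℤ) (X : C) :
    Nonempty (δ.obj (Opposite.op ((tw n).functor.obj X)) ≅
      (tw (-n)).functor.obj (δ.obj (Opposite.op X))) :=
  nonempty_op_action_iso (fun n => (tw n).functor) hδ.zero hδ.add δ hδ.twist_one n X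

end IsTwistDuality

lemma nonempty_map_biproduct_iso (F G : C ⥤ C) [F.Additive] [G.Additive] {n : ℕ} (g : Fin n → C)
    (h : ∀ i, Nonempty (F.obj (g i) ≅ G.obj (g i))) :
    Nonempty (F.obj (⨁ g) ≅ G.obj (⨁ g)) := by
  exact ⟨F.mapBiproduct g ≪≫ biproduct.mapIso (fun i => (h i).some) ≪≫ (G.mapBiproduct g).symm⟩

section Stability

variable {tw : ℤ → (C ≌ C)} {δ : Cᵒᵖ ⥤ C} [δ.IsEquivalence] {S : Set C}

/-- An indecomposable of `S` is isomorphic to its dual up to a twist. -/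
lemma exists_dual_twist_iso (hδ : IsTwistDuality tw δ) (hS : DualityConditions tw δ S)
    {X : C} (hX : X ∈ S) (hX' : IsLocalRing (End X)) :
    ∃ k : ℤ, Nonempty (δ.obj (Opposite.op X) ≅ (tw k).functor.obj X) := by
  obtain ⟨m, hm, -⟩ := hS.2.2 X hX hX'
  refine ⟨m + m, ?_⟩
  have e := nonempty_iso_trans (nonempty_iso_symm (hδ.twist m X)) hm
  exact nonempty_iso_trans (nonempty_iso_symm (hδ.cancel (add_neg_cancel m) _))
    (nonempty_iso_trans (nonempty_map_iso (tw m).functor e) (hδ.add m m X))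

lemma nonempty_dual_dual_iso (hδ : IsTwistDuality tw δ) (hS : DualityConditions tw δ S)
    {X : C} (hX : X ∈ S) :
    Nonempty (δ.obj (Opposite.op (δ.obj (Opposite.op X))) ≅ X) := by
  have : (δ.rightOp ⋙ δ).Additive := additive_of_isEquivalence _
  obtain ⟨n, g, hg, e⟩ := hS.2.1 X hX
  have key : Nonempty ((δ.rightOp ⋙ δ).obj (⨁ g) ≅ (𝟭 C).obj (⨁ g)) :=
    nonempty_map_biproduct_iso (δ.rightOp ⋙ δ) (𝟭 C) g fun i => by
      obtain ⟨k, hk⟩ := exists_dual_twist_iso hδ hS (hg i).1 (hg i).2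
      exact nonempty_iso_trans (nonempty_op_iso δ hk) (nonempty_iso_trans (hδ.twist k (g i))
        (nonempty_iso_trans (nonempty_map_iso (tw (-k)).functor hk)
          (hδ.cancel (neg_add_cancel k) (g i))))
  exact nonempty_iso_trans (nonempty_op_iso δ (nonempty_op_iso δ e))
    (nonempty_iso_trans key (nonempty_iso_symm e))

lemma twist_mem (hδ : IsTwistDuality tw δ)
    (hiso : ∀ {X Y : C}, X ∈ S → Nonempty (X ≅ Y) → Y ∈ S) (hS : DualityConditions tw δ S)
    (n : ℤ) {X : C} (hX : X ∈ S) : (tw n).functor.obj X ∈ S := by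
  have hnat : ∀ (n : ℕ) {X : C}, X ∈ S → (tw n).functor.obj X ∈ S := by
    intro n
    induction n with
    | zero => exact fun {X} hX => hiso hX (nonempty_iso_symm (by simpa using hδ.zero X))
    | succ n ih =>
      intro X hX
      exact hiso (ih (hS.1 X hX).1) (by exact_mod_cast hδ.add n 1 X)
  rcases le_total 0 n with h | h
  · obtain ⟨m, rfl⟩ := Int.eq_ofNat_of_zero_le h
    exact hnat m hX
  · obtain ⟨m, rfl⟩ : ∃ m : ℕ, n = -m := ⟨(-n).toNat, by omega⟩
    refine hiso (hS.1 _ (hnat m (hS.1 X hX).2)).2 ?_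
    exact nonempty_iso_trans (hδ.twist m _)
      (nonempty_map_iso (tw (-m)).functor (nonempty_dual_dual_iso hδ hS hX))

end Stability

end Duality

section Uniqueness

variable {t : CoTStructure C} {tw : ℤ → (C ≌ C)} {δ : Cᵒᵖ ⥤ C}

/-- The contravariant functor `Y ↦ δ(Y⟦n⟧)⟨k⟩⟦n⟧`. -/
def twistedDual (tw : ℤ → (C ≌ C)) (δ : Cᵒᵖ ⥤ C) (n k : ℤ) : Cᵒᵖ ⥤ C :=
  (shiftFunctor C n).op ⋙ δ ⋙ (tw k).functor ⋙ shiftFunctor C n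

/-- The twists `tw (-k)` and `tw k` cancel on `s` even if a negative shift is inserted. -/
def TwistCompatible (tw : ℤ → (C ≌ C)) (k : ℤ) (s : C) : Prop :=
  ∀ j : ℕ, Nonempty ((tw k).functor.obj (((tw (-k)).functor.obj s)⟦(-j : ℤ)⟧) ≅ s⟦(-j : ℤ)⟧)

lemma TwistCompatible.of_not_isolated (hδ : IsTwistDuality tw δ) (k : ℤ) {s : C}
    (hs : HasLocalEnd s) (hs' : ¬ Isolated s) : TwistCompatible tw k s := by
  intro j
  have := additive_of_isEquivalence (tw k).functor
  have := additive_of_isEquivalence (tw (-k)).functor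
  exact nonempty_iso_trans (nonempty_map_shift_neg_iso (tw k).functor (hs.map (tw (-k)).functor)
    (fun h => hs' (h.of_map _)) j)
    (nonempty_map_iso (shiftFunctor C (-j : ℤ)) (hδ.cancel (add_neg_cancel k) s))

lemma TwistCompatible.biproduct {k : ℤ} {n : ℕ} {g : Fin n → C}
    (hg : ∀ i, TwistCompatible tw k (g i)) : TwistCompatible tw k (⨁ g) := by
  intro j
  have := additive_of_isEquivalence (tw k).functor
  have := additive_of_isEquivalence (tw (-k)).functor
  exact nonempty_map_biproduct_iso
    ((tw (-k)).functor ⋙ shiftFunctor C (-j : ℤ) ⋙ (tw k).functor) (shiftFunctor C (-j : ℤ)) g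
    fun i => hg i j

lemma TwistCompatible.of_isZero {k : ℤ} {s : C} (hs : IsZero s) : TwistCompatible tw k s := by
  intro j
  have := additive_of_isEquivalence (tw k).functor
  have := additive_of_isEquivalence (tw (-k)).functor
  have h := ((tw (-k)).functor ⋙ shiftFunctor C (-j : ℤ) ⋙ (tw k).functor).map_isZero hs
  exact ⟨h.iso ((shiftFunctor C (-j : ℤ)).map_isZero hs)⟩

lemma exists_hom_ne_zero {S : Set C} (hS : IsSiltingSubcat S) {X : C} (hX : 𝟙 X ≠ 0) :
    ∃ s ∈ S, ∃ (k : ℤ) (f : X⟦k⟧ ⟶ s), f ≠ 0 := by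
  by_contra! hne
  have h := hS.2.2.2.2.2 {Y | ∀ (k : ℤ) (f : X⟦k⟧ ⟶ Y), f = 0} (fun s hs k f => hne s hs k f)
    (fun h e k => hom_zero_of_iso ⟨Iso.refl _⟩ (nonempty_iso_symm e) (h k))
    (fun Y hY => ⟨fun k => hom_zero_of_shift (-1) (hom_zero_of_iso (nonempty_shift_add X rfl)
        (nonempty_shift_cancel Y (by norm_num)) (hY (k + -1))),
      fun k => hom_zero_of_shift 1 (hom_zero_of_iso (nonempty_shift_add X rfl)
        (nonempty_shift_cancel Y (by norm_num)) (hY (k + 1)))⟩)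
    (fun T hT h₁ h₃ k f => by
      obtain ⟨b, rfl⟩ := Triangle.coyoneda_exact₂ T hT f (h₃ k _)
      rw [h₁ k b, zero_comp]) X
  exact hX (hom_zero_of_iso (nonempty_iso_symm (nonempty_shift_zero X rfl)) ⟨Iso.refl _⟩ (h 0) _)

lemma mem_of_isolated (hδ : IsTwistDuality tw δ) {S : Set C} (hS : DualityConditions tw δ S)
    (hSsilt : IsSiltingSubcat S) {X : C} (hX : 𝟙 X ≠ 0) (hX' : Isolated X)
    (hdual : Nonempty (δ.obj (Opposite.op X) ≅ X)) : X ∈ S := by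
  obtain ⟨s, hs, k, f, hf⟩ := exists_hom_ne_zero hSsilt hX
  have hpos : X⟦k⟧ ∈ S := hSsilt.2.2.2.1 hs ⟨f, hX'.map (shiftFunctor C k) f hf⟩
  have hneg : X⟦-k⟧ ∈ S := hSsilt.1 (hS.1 _ hpos).2
    (nonempty_iso_trans (hδ.shift k X) (nonempty_map_iso (shiftFunctor C (-k)) hdual))
  have key : ∀ m : ℤ, 0 < m → X⟦m⟧ ∈ S → X⟦-m⟧ ∈ S → False := fun m hm h h' => hX <|
    hom_zero_of_shift m (hom_zero_of_iso ⟨Iso.refl _⟩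
      (nonempty_iso_symm (nonempty_shift_add X (show -m + (m + m) = m by ring)))
      (hSsilt.2.2.2.2.1 _ h _ h' (m + m) (by omega))) _
  rcases lt_trichotomy k 0 with hk | rfl | hk
  · exact (key (-k) (by omega) hneg (by rwa [neg_neg])).elim
  · exact hSsilt.1 hpos (nonempty_shift_zero X rfl)
  · exact (key k hk hpos hneg).elim

variable [δ.IsEquivalence]

instance twistedDual_isEquivalence (n k : ℤ) : (twistedDual tw δ n k).IsEquivalence := by
  unfold twistedDual
  infer_instance

lemma nonempty_twistedDual_obj_iso (hδ : IsTwistDuality tw δ) {S : Set C}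
    (hS : DualityConditions tw δ S)
    (hiso : ∀ {X Y : C}, X ∈ S → Nonempty (X ≅ Y) → Y ∈ S) (n : ℕ) {k : ℤ} {s : C} (hs : s ∈ S)
    (hs' : TwistCompatible tw k s) :
    ∃ s' ∈ S, ∀ j : ℕ, Nonempty ((twistedDual tw δ n k).obj (Opposite.op (s'⟦(j : ℤ)⟧)) ≅
      s⟦(-j : ℤ)⟧) := by
  have hk := twist_mem hδ hiso hS (-k) hs
  refine ⟨_, (hS.1 _ hk).2, fun j => ?_⟩
  have e₁ := nonempty_op_iso δ (nonempty_shift_add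
    (δ.obj (Opposite.op ((tw (-k)).functor.obj s))) (m := j) (n := n) (k := (j + n : ℕ))
    (by push_cast; rfl))
  have e₂ := nonempty_iso_trans (hδ.shift ((j + n : ℕ) : ℤ) _) (nonempty_map_iso
    (shiftFunctor C (-(j + n : ℕ) : ℤ)) (nonempty_dual_dual_iso hδ hS hk))
  have e₃ := nonempty_iso_trans (nonempty_map_iso (tw k).functor (nonempty_iso_trans e₁ e₂))
    (hs' (j + n))
  exact nonempty_iso_trans (nonempty_map_iso (shiftFunctor C (n : ℤ)) e₃)
    (nonempty_shift_add s (by push_cast; ring))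

/-- The twisted dual sends `X⟦-n⟧` to `X⟨k⟩⟦n⟧` if `X` is self-dual. -/
lemma nonempty_twistedDual_shift_neg_iso {X : C} (hX : Nonempty (δ.obj (Opposite.op X) ≅ X))
    (n k : ℤ) : Nonempty ((twistedDual tw δ n k).obj (Opposite.op (X⟦-n⟧)) ≅
      ((tw k).functor.obj X)⟦n⟧) :=
  nonempty_map_iso ((tw k).functor ⋙ shiftFunctor C n) (nonempty_iso_trans
    (nonempty_op_iso δ (nonempty_shift_cancel X (neg_add_cancel n))) hX)

/-- The twisted dual fixes objects whose dual is the appropriate twist. -/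
lemma nonempty_twistedDual_self_iso (hδ : IsTwistDuality tw δ) {M : C} {k : ℤ}
    (hM : HasLocalEnd M) (hM' : ¬ Isolated M)
    (e : Nonempty (δ.obj (Opposite.op M) ≅ (tw (-k)).functor.obj M)) (n : ℕ) :
    Nonempty ((twistedDual tw δ n k).obj (Opposite.op M) ≅ M) := by
  have e₁ := nonempty_iso_trans (hδ.shift n M)
    (nonempty_map_iso (shiftFunctor C (-n : ℤ)) e)
  have e₂ := nonempty_iso_trans (nonempty_map_iso (tw k).functor e₁)
    (TwistCompatible.of_not_isolated hδ k hM hM' n)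
  exact nonempty_iso_trans (nonempty_map_iso (shiftFunctor C (n : ℤ)) e₂)
    (nonempty_shift_cancel M (by ring))

lemma twist_shift_mem_le (ht : t.bounded) (hδ : IsTwistDuality tw δ)
    (hS : DualityConditions tw δ t.coheart) (hSsilt : IsSiltingSubcat t.coheart) {X : C}
    (hX : HasLocalEnd X) (hX' : ¬ Isolated X) (hdual : Nonempty (δ.obj (Opposite.op X) ≅ X))
    (n : ℕ) (k : ℤ) (hn : X⟦(-n : ℤ)⟧ ∈ t.ge) : ((tw k).functor.obj X)⟦(n : ℤ)⟧ ∈ t.le := by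
  refine mem_le_of_coheart_hom_zero t ht fun s hs j hj => ?_
  obtain ⟨N, g, hg, e⟩ := hS.2.1 s hs
  refine hom_zero_of_iso e ⟨Iso.refl _⟩ fun f => biproduct.hom_ext' _ _ fun i => ?_
  rw [comp_zero]
  have := additive_of_isEquivalence (tw k).functor
  have hloc := HasLocalEnd.of_isLocalRing (hg i).2
  by_cases hiso : Isolated (g i)
  · by_contra hne
    have hY := hiso.of_hom_from ((((hX.map (tw k).functor).map (shiftFunctor C (n : ℤ)))).map
      (shiftFunctor C (j : ℤ))) hne
    exact hX' (((hY.of_map _).of_map _).of_map _)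
  obtain ⟨s', hs', hs''⟩ := nonempty_twistedDual_obj_iso hδ hS hSsilt.1 n (hg i).1
    (TwistCompatible.of_not_isolated hδ k hloc hiso)
  refine hom_zero_of_shift (-j : ℤ) (hom_zero_of_iso (nonempty_iso_symm (hs'' j))
    (nonempty_iso_trans (nonempty_shift_cancel _ (add_neg_cancel _))
      (nonempty_iso_symm (nonempty_twistedDual_shift_neg_iso hdual n k))) fun a => ?_) _
  obtain ⟨a, rfl⟩ := (twistedDual tw δ n k).map_surjective a
  rw [show a = 0 from Quiver.Hom.unop_inj
    (hom_zero_shift t hn hs'.2 (by exact_mod_cast hj) a.unop), Functor.map_zero]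

/-- A morphism from a non-isolated indecomposable into the coheart factors through a summand of
its target on which the twists are compatible with negative shifts. -/
lemma exists_twistCompatible_factor (hδ : IsTwistDuality tw δ)
    (hS : DualityConditions tw δ t.coheart) (hSsilt : IsSiltingSubcat t.coheart) (k : ℤ) {M c : C}
    (hM : HasLocalEnd M) (hM' : ¬ Isolated M) (hc : c ∈ t.coheart) (r : M ⟶ c) :
    ∃ c₀ ∈ t.coheart, TwistCompatible tw k c₀ ∧ ∃ (d : c ⟶ c₀) (d' : c₀ ⟶ c),
      r ≫ d ≫ d' = r := by
  classical
  obtain ⟨N, g, hg, ⟨e⟩⟩ := hS.2.1 c hc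
  have key : ∀ i, ∃ g' ∈ t.coheart, TwistCompatible tw k g' ∧ ∃ (d : g i ⟶ g') (d' : g' ⟶ g i),
      (r ≫ e.hom ≫ biproduct.π g i) ≫ d ≫ d' = r ≫ e.hom ≫ biproduct.π g i := by
    intro i
    by_cases hi : Isolated (g i)
    · refine ⟨0, hSsilt.2.1, TwistCompatible.of_isZero (isZero_zero C), 0, 0, ?_⟩
      by_contra hne
      exact hM' (hi.of_hom_to hM (f := r ≫ e.hom ≫ biproduct.π g i) fun h0 => hne (by
        rw [h0, zero_comp]))
    · exact ⟨g i, (hg i).1, TwistCompatible.of_not_isolated hδ k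
        (HasLocalEnd.of_isLocalRing (hg i).2) hi, 𝟙 _, 𝟙 _, by simp⟩
  choose g' hg' hcomp d d' hd using key
  refine ⟨⨁ g', biproduct_mem_coheart t g' hg', TwistCompatible.biproduct hcomp,
    e.hom ≫ biproduct.map d, biproduct.map d' ≫ e.inv, ?_⟩
  have h : (r ≫ e.hom) ≫ biproduct.map d ≫ biproduct.map d' = r ≫ e.hom :=
    biproduct.hom_ext _ _ fun i => by simpa using hd i
  calc r ≫ (e.hom ≫ biproduct.map d) ≫ biproduct.map d' ≫ e.inv
      = ((r ≫ e.hom) ≫ biproduct.map d ≫ biproduct.map d') ≫ e.inv := by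
        simp only [Category.assoc]
    _ = r := by rw [h]; simp

lemma shift_neg_mem_ge_of_succ (ht : t.bounded) (hδ : IsTwistDuality tw δ)
    (hS : DualityConditions tw δ t.coheart) (hSsilt : IsSiltingSubcat t.coheart) {X : C}
    (hX : HasLocalEnd X) (hX' : ¬ Isolated X) (hdual : Nonempty (δ.obj (Opposite.op X) ≅ X))
    (hself : ∀ m k : ℤ, 0 < m → ∀ f : X ⟶ ((tw k).functor.obj X)⟦m⟧, f = 0)
    (n : ℕ) (hn0 : 0 < n) (hn : X⟦(-n : ℤ)⟧ ∈ t.ge) : X⟦(-n : ℤ)⟧⟦(1 : ℤ)⟧ ∈ t.ge := by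
  by_contra hW
  obtain ⟨M, hM, hMloc, x, hx, hxS, hxL⟩ := exists_minimal_component t hS.2.1 hn hW
  have hM' : ¬ Isolated M := fun h =>
    hX' ((h.of_hom_to (hX.map (shiftFunctor C (-n : ℤ))) hx).of_map _)
  have hMend := HasLocalEnd.of_isLocalRing hMloc
  obtain ⟨k, hk⟩ : ∃ k : ℤ, Nonempty (δ.obj (Opposite.op M) ≅ (tw (-k)).functor.obj M) := by
    obtain ⟨k, hk⟩ := exists_dual_twist_iso hδ hS hM hMloc
    exact ⟨-k, by rwa [neg_neg]⟩
  let Φ := twistedDual tw δ n k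
  obtain ⟨eM⟩ : Nonempty (Φ.obj (Opposite.op M) ≅ M) :=
    nonempty_twistedDual_self_iso hδ hMend hM' hk n
  obtain ⟨eY⟩ := nonempty_twistedDual_shift_neg_iso (tw := tw) hdual n k
  change Φ.obj _ ≅ _ at eY
  have hxy : x ≫ eM.inv ≫ Φ.map x.op ≫ eY.hom = 0 :=
    hom_zero_of_shift (n : ℤ) (hom_zero_of_iso (nonempty_shift_cancel X (neg_add_cancel _))
      (nonempty_shift_add _ rfl) (hself (n + n) k (by omega))) _
  obtain ⟨c, hc, r, γ, hrγ, hr⟩ := hxL _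
    (twist_shift_mem_le ht hδ hS hSsilt hX hX' hdual n k hn) _ hxy
  obtain ⟨c₀, hc₀, hcomp, d, d', hd⟩ :=
    exists_twistCompatible_factor hδ hS hSsilt k hMend hM' hc r
  obtain ⟨s, hs, hs'⟩ := nonempty_twistedDual_obj_iso hδ hS hSsilt.1 n hc₀ hcomp
  obtain ⟨e₀⟩ : Nonempty (Φ.obj (Opposite.op (s⟦((0 : ℕ) : ℤ)⟧)) ≅ c₀) :=
    nonempty_iso_trans (hs' 0) (nonempty_shift_zero c₀ (by simp))
  have hs₀ : s⟦((0 : ℕ) : ℤ)⟧ ∈ t.coheart :=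
    hSsilt.1 hs (nonempty_iso_symm (nonempty_shift_zero s (by simp)))
  obtain ⟨ρ, hρ⟩ := Φ.map_surjective (eM.hom ≫ (r ≫ d) ≫ e₀.inv)
  obtain ⟨q, hq⟩ := Φ.map_surjective (e₀.hom ≫ (d' ≫ γ) ≫ eY.inv)
  have hfac : q.unop ≫ ρ.unop = x := by
    apply Quiver.Hom.op_inj
    apply Φ.map_injective
    rw [op_comp, Quiver.Hom.op_unop, Quiver.Hom.op_unop, Φ.map_comp, hρ, hq,
      ← cancel_mono eY.hom, ← cancel_epi eM.inv, ← hrγ]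
    conv_rhs => rw [← hd]
    simp
  obtain ⟨σ, hσ⟩ := hxS _ hs₀ q.unop ρ.unop hfac
  refine hr ⟨d ≫ e₀.inv ≫ Φ.map σ.op ≫ eM.hom, ?_⟩
  have h : Φ.map ρ ≫ Φ.map σ.op = 𝟙 _ := by
    rw [← Φ.map_comp, ← Φ.map_id]
    exact congrArg Φ.map (Quiver.Hom.unop_inj hσ)
  rw [hρ] at h
  have h' := congrArg (fun a => eM.inv ≫ a ≫ eM.hom) h
  simpa using h'

lemma mem_coheart_of_not_isolated (ht : t.bounded) (hδ : IsTwistDuality tw δ)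
    (hS : DualityConditions tw δ t.coheart) (hSsilt : IsSiltingSubcat t.coheart) {X : C}
    (hX : HasLocalEnd X) (hX' : ¬ Isolated X) (hdual : Nonempty (δ.obj (Opposite.op X) ≅ X))
    (hself : ∀ m k : ℤ, 0 < m → ∀ f : X ⟶ ((tw k).functor.obj X)⟦m⟧, f = 0) :
    X ∈ t.coheart := by
  have key : ∀ n : ℕ, X⟦(-n : ℤ)⟧ ∈ t.ge → X ∈ t.ge := by
    intro n
    induction n with
    | zero => exact mem_ge_of_iso t (nonempty_shift_zero X (by simp))
    | succ n ih =>
      intro hn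
      exact ih (mem_ge_of_iso t (nonempty_shift_add X (by push_cast; ring))
        (shift_neg_mem_ge_of_succ ht hδ hS hSsilt hX hX' hdual hself (n + 1) n.succ_pos hn))
  have hge : X ∈ t.ge := by
    obtain ⟨n, hn⟩ := (ht X).1
    refine key (-n).toNat ?_
    exact mem_ge_of_iso t (nonempty_shift_add X (by omega))
      (shift_neg_mem_ge t hn (n + (-n).toNat).toNat)
  refine ⟨hge, mem_le_of_iso t (nonempty_iso_trans (nonempty_shift_zero _ (by simp)) (hδ.zero X))
    (twist_shift_mem_le ht hδ hS hSsilt hX hX' hdual 0 0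
      (mem_ge_of_iso t (nonempty_iso_symm (nonempty_shift_zero X (by simp))) hge))⟩

lemma subset_coheart (ht : t.bounded) (hδ : IsTwistDuality tw δ)
    (hS : DualityConditions tw δ t.coheart) (hSsilt : IsSiltingSubcat t.coheart) {S' : Set C}
    (hS'silt : IsSiltingSubcat S') (hS' : DualityConditions tw δ S') : S' ⊆ t.coheart := by
  intro X hX
  obtain ⟨N, g, hg, e⟩ := hS'.2.1 X hX
  refine hSsilt.1 (biproduct_mem_coheart t g fun i => ?_) (nonempty_iso_symm e)
  obtain ⟨n, hn, -⟩ := hS'.2.2 (g i) (hg i).1 (hg i).2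
  have := additive_of_isEquivalence (tw n).functor
  have hloc := (HasLocalEnd.of_isLocalRing (hg i).2).map (tw n).functor
  have hmem := twist_mem hδ hS'silt.1 hS' n (hg i).1
  refine hSsilt.1 (twist_mem hδ hSsilt.1 hS (-n) ?_) (hδ.cancel (neg_add_cancel n) (g i))
  by_cases hiso : Isolated ((tw n).functor.obj (g i))
  · exact mem_of_isolated hδ hS hSsilt hloc.1 hiso hn
  · exact mem_coheart_of_not_isolated ht hδ hS hSsilt hloc hiso hn fun m k hm =>
      hS'silt.2.2.2.2.1 _ hmem _ (twist_mem hδ hS'silt.1 hS' k hmem) m hm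

end Uniqueness

end SiltingDuality

/-- Uniqueness of silting subcategories preserved by a duality: let `D` be a
triangulated category with a bounded co-t-structure whose coheart `S` is
Krull–Schmidt, let `δ` be a triangulated antiautoequivalence and `⟦n⟧ = tw n` a Tate
twist with `δ ∘ ⟦1⟧ ≅ ⟦-1⟧ ∘ δ`, such that `S` is stable under `δ` and `⟦1⟧` and each
indecomposable of `S` has a unique `n` with `δ(S₀⟦n⟧) ≅ S₀⟦n⟧`.  Then any silting
subcategory `S'` of `D` satisfying the same three conditions equals `S`. -/
theorem stmt_11
    (t : CoTStructure C) (ht : t.bounded)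
    (tw : ℤ → (C ≌ C))
    (htw0 : ∀ X : C, Nonempty ((tw 0).functor.obj X ≅ X))
    (htwadd : ∀ (m n : ℤ) (X : C),
      Nonempty ((tw m).functor.obj ((tw n).functor.obj X) ≅ (tw (m + n)).functor.obj X))
    (δ : Cᵒᵖ ⥤ C) [δ.IsEquivalence]
    (hδshift : ∀ X : C,
      Nonempty (δ.obj (Opposite.op (X⟦(1 : ℤ)⟧)) ≅ (δ.obj (Opposite.op X))⟦(-1 : ℤ)⟧))
    (hδtri : ∀ T ∈ (distinguishedTriangles : Set (Triangle C)),
      Triangle.mk (δ.map T.mor₂.op) (δ.map T.mor₁.op)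
        ((shiftEquiv C (1 : ℤ)).counitIso.inv.app (δ.obj (Opposite.op T.obj₁)) ≫
          (((hδshift T.obj₁).some.inv ≫ δ.map T.mor₃.op)⟦(1 : ℤ)⟧')) ∈
        distinguishedTriangles)
    (hcomm : ∀ X : C,
      Nonempty (δ.obj (Opposite.op ((tw 1).functor.obj X)) ≅
        (tw (-1)).functor.obj (δ.obj (Opposite.op X))))
    (hS : DualityConditions tw δ t.coheart)
    (hSsilt : IsSiltingSubcat t.coheart) :
    ∀ S' : Set C, IsSiltingSubcat S' → DualityConditions tw δ S' → S' = t.coheart := by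
  have hδ : SiltingDuality.IsTwistDuality tw δ := ⟨htw0, htwadd, hδshift, hcomm⟩
  intro S' hS'silt hS'
  have h := SiltingDuality.subset_coheart ht hδ hS hSsilt hS'silt hS'
  exact Set.Subset.antisymm h (SiltingDuality.coheart_subset_of_isSiltingSubcat hS'silt h)
end
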